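/- arXiv:1708.09017 — 6 statements merged into one kernel-verified Lean document; each statement's English description precedes it below -/
import Mathlib

section
/- Let d ≥ 2 be an even integer and m an integer with m > d/2. Then the function φ(x) = ‖x‖^{2m−d} · log‖x‖ on ℝ^d satisfies Δ^m φ(x) = 0 for every x ≠ 0; that is, φ is polyharmonic of order m away from the origin. -/
open MeasureTheory

/-- The Laplacian on `ℝ^d`: the sum of the unmixed second partial derivatives. -/
noncomputable def laplacian {d : ℕ} (f : EuclideanSpace ℝ (Fin d) → ℝ)
    (x : EuclideanSpace ℝ (Fin d)) : ℝ :=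
  ∑ i : Fin d,
    fderiv ℝ (fun y => fderiv ℝ f y (EuclideanSpace.single i 1)) x (EuclideanSpace.single i 1)

/-- The directional derivative of a radial function away from the origin. -/
lemma fderiv_radial_apply {E : Type*} [NormedAddCommGroup E] [InnerProductSpace ℝ E]
    {f : E → ℝ} {g g' : ℝ → ℝ} (hg : ∀ s > 0, HasDerivAt g (g' s) s)
    (hf : ∀ y ≠ 0, f y = g (‖y‖ ^ 2)) {x : E} (hx : x ≠ 0) (v : E) :
    fderiv ℝ f x v = g' (‖x‖ ^ 2) * (2 * inner ℝ x v) := by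
  have hev : f =ᶠ[nhds x] fun y => g (‖y‖ ^ 2) := by
    filter_upwards [isOpen_ne.mem_nhds hx] with y hy using hf y hy
  have h := (hg (‖x‖ ^ 2) (by positivity)).comp_hasFDerivAt x
    (hasStrictFDerivAt_norm_sq x).hasFDerivAt
  have h' := h.fderiv
  simp only [Function.comp_def] at h'
  rw [hev.fderiv_eq, h']
  simp

/-- The Laplacian of a radial function `y ↦ g (‖y‖ ^ 2)` away from the origin. -/
lemma laplacian_radial {d : ℕ} {f : EuclideanSpace ℝ (Fin d) → ℝ} {g g' g'' : ℝ → ℝ}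
    (hg : ∀ s > 0, HasDerivAt g (g' s) s) (hg' : ∀ s > 0, HasDerivAt g' (g'' s) s)
    (hf : ∀ y ≠ 0, f y = g (‖y‖ ^ 2)) {x : EuclideanSpace ℝ (Fin d)} (hx : x ≠ 0) :
    laplacian f x = 4 * ‖x‖ ^ 2 * g'' (‖x‖ ^ 2) + 2 * d * g' (‖x‖ ^ 2) := by
  have key (i : Fin d) : fderiv ℝ (fun y => fderiv ℝ f y (EuclideanSpace.single i 1)) x
      (EuclideanSpace.single i 1) = 4 * g'' (‖x‖ ^ 2) * (x i) ^ 2 + 2 * g' (‖x‖ ^ 2) := by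
    have hev : (fun y => fderiv ℝ f y (EuclideanSpace.single i 1)) =ᶠ[nhds x]
        fun y => g' (‖y‖ ^ 2) * (2 * inner ℝ (EuclideanSpace.single i (1 : ℝ)) y) := by
      filter_upwards [isOpen_ne.mem_nhds hx] with y hy
      rw [fderiv_radial_apply hg hf hy, real_inner_comm]
    have h1 := (hg' (‖x‖ ^ 2) (by positivity)).comp_hasFDerivAt x
      (hasStrictFDerivAt_norm_sq x).hasFDerivAt
    have h2 := ((innerSL ℝ (EuclideanSpace.single i (1 : ℝ))).hasFDerivAt (x := x)).const_mul 2
    have h3 := (h1.mul h2).fderiv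
    simp only [Function.comp_def, Pi.mul_def, innerSL_apply_apply] at h3
    rw [hev.fderiv_eq, h3]
    simp [real_inner_comm, EuclideanSpace.inner_single_right]
    ring
  rw [laplacian, Finset.sum_congr rfl fun i _ => key i, Finset.sum_add_distrib, ← Finset.mul_sum,
    EuclideanSpace.real_norm_sq_eq]
  simp
  ring

/-- The Laplacian maps `r ^ (2p) (a log r² + b)` to a function of the same form, with `p - 1`
in place of `p`. -/
lemma laplacian_zpow_mul_log {d : ℕ} {f : EuclideanSpace ℝ (Fin d) → ℝ} {p : ℤ} {a b : ℝ}
    (hf : ∀ y ≠ 0, f y = (‖y‖ ^ 2) ^ p * (a * Real.log (‖y‖ ^ 2) + b))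
    {x : EuclideanSpace ℝ (Fin d)} (hx : x ≠ 0) :
    laplacian f x = (‖x‖ ^ 2) ^ (p - 1) *
      (2 * p * (2 * p - 2 + d) * a * Real.log (‖x‖ ^ 2) +
        (2 * p * (2 * p - 2 + d) * b + 2 * (4 * p - 2 + d) * a)) := by
  have hderiv (q : ℤ) (a b : ℝ) (s : ℝ) (hs : 0 < s) :
      HasDerivAt (fun s => s ^ q * (a * Real.log s + b))
        (s ^ (q - 1) * (q * a * Real.log s + (q * b + a))) s := by
    have h := (hasDerivAt_zpow q s (Or.inl hs.ne')).mul
      (((Real.hasDerivAt_log hs.ne').const_mul a).add_const b)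
    refine h.congr_deriv ?_
    rw [zpow_sub_one₀ hs.ne']
    field_simp
    ring
  rw [laplacian_radial (hderiv p a b) (hderiv (p - 1) (p * a) (p * b + a)) hf hx]
  have hs : ‖x‖ ^ 2 ≠ 0 := by positivity
  rw [zpow_sub_one₀ hs (p - 1)]
  push_cast
  field_simp
  ring

/-- For even `d ≥ 2` and `m > d/2`, the surface spline `φ(x) = ‖x‖^{2m-d} log‖x‖` is
polyharmonic of order `m` away from the origin: `Δ^m φ(x) = 0` for `x ≠ 0`. -/
theorem surfSpline_even_polyharmonic (m d : ℕ) (heven : Even d) (hd : 2 ≤ d) (hm : d < 2 * m)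
    (x : EuclideanSpace ℝ (Fin d)) (hx : x ≠ 0) :
    (laplacian (d := d))^[m] (fun y => ‖y‖ ^ (2 * (m : ℝ) - d) * Real.log ‖y‖) x = 0 := by
  obtain ⟨k, rfl⟩ := heven
  set φ : EuclideanSpace ℝ (Fin (k + k)) → ℝ :=
    fun y => ‖y‖ ^ (2 * (m : ℝ) - (k + k : ℕ)) * Real.log ‖y‖
  have hiter (j : ℕ) : ∃ a b : ℝ, ((m : ℤ) - k - j < 0 → a = 0) ∧ ∀ y ≠ 0,
      laplacian^[j] φ y = (‖y‖ ^ 2) ^ ((m : ℤ) - k - j) * (a * Real.log (‖y‖ ^ 2) + b) := by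
    induction j with
    | zero =>
      refine ⟨1 / 2, 0, fun h => by omega, fun y hy => ?_⟩
      have hpow : ‖y‖ ^ (2 * (m : ℝ) - (k + k : ℕ)) = (‖y‖ ^ 2) ^ ((m : ℤ) - k - (0 : ℕ)) := by
        rw [← zpow_natCast, ← zpow_mul, ← Real.rpow_intCast]
        push_cast
        ring_nf
      simp only [Function.iterate_zero, id_eq, φ]
      rw [hpow, Real.log_pow]
      push_cast
      ring
    | succ j ih =>
      obtain ⟨a, b, ha, hφ⟩ := ih
      have hq : (m : ℤ) - k - (j + 1 : ℕ) = (m : ℤ) - k - j - 1 := by push_cast; ring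
      rw [hq]
      generalize (m : ℤ) - k - j = q at *
      refine ⟨2 * q * (2 * q - 2 + (k + k : ℕ)) * a,
        2 * q * (2 * q - 2 + (k + k : ℕ)) * b + 2 * (4 * q - 2 + (k + k : ℕ)) * a,
        fun h => ?_, fun y hy => ?_⟩
      · rcases (show q ≤ 0 by omega).lt_or_eq with h' | h'
        · simp [ha h']
        · simp [h']
      · rw [Function.iterate_succ_apply', laplacian_zpow_mul_log hφ hy]
  obtain ⟨n, rfl⟩ : ∃ n, m = n + 1 := ⟨m - 1, by omega⟩
  obtain ⟨a, b, ha, hφ⟩ := hiter n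
  rw [Function.iterate_succ_apply', laplacian_zpow_mul_log hφ hx]
  have hk : a * ((k : ℝ) - 1) = 0 := by
    rcases (show 1 ≤ k by omega).eq_or_lt with rfl | h
    · simp
    · simp [ha (by push_cast; omega)]
  have ha' : 2 * (4 * (1 - (k : ℝ)) - 2 + (k + k)) * a = 0 := by linear_combination -4 * hk
  push_cast
  rw [show (n : ℝ) + 1 - k - n = 1 - k by ring, ha']
  ring
end

section
/- Let d ≥ 1 be an odd integer and m an integer with m > d/2. There exists a nonzero real constant c such that for every smooth compactly supported function ψ : ℝ^d → ℝ, one has ∫_{ℝ^d} ‖x‖^{2m−d} · (Δ^m ψ)(x) dx = c · ψ(0). In other words, ‖·‖^{2m−d} is, up to the constant c, a fundamental solution of Δ^m in the sense of distributions. -/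
open MeasureTheory

section SurfaceSpline

open Filter Topology Set

variable {d : ℕ}

/-! ### The Laplacian of smooth functions -/

lemma ContDiff.fderiv_apply_const {u : EuclideanSpace ℝ (Fin d) → ℝ}
    (hu : ContDiff ℝ (⊤ : ℕ∞) u) (v : EuclideanSpace ℝ (Fin d)) :
    ContDiff ℝ (⊤ : ℕ∞) (fun y => fderiv ℝ u y v) :=
  (hu.fderiv_right (m := ((⊤ : ℕ∞) : WithTop ℕ∞)) (by simp)).clm_apply contDiff_const

lemma ContDiff.laplacian {u : EuclideanSpace ℝ (Fin d) → ℝ}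
    (hu : ContDiff ℝ (⊤ : ℕ∞) u) : ContDiff ℝ (⊤ : ℕ∞) (_root_.laplacian u) :=
  ContDiff.sum fun _ _ => (hu.fderiv_apply_const _).fderiv_apply_const _

lemma HasCompactSupport.laplacian {u : EuclideanSpace ℝ (Fin d) → ℝ}
    (hu : HasCompactSupport u) : HasCompactSupport (_root_.laplacian u) := by
  refine hu.mono' fun x hx => ?_
  by_contra h
  refine hx (Finset.sum_eq_zero fun i _ => ?_)
  have h1 : x ∉ tsupport fun y => fderiv ℝ u y (EuclideanSpace.single i 1) :=
    fun h' => h (tsupport_fderiv_apply_subset ℝ _ h')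
  have h2 := fun h' => h1 (tsupport_fderiv_apply_subset ℝ (EuclideanSpace.single i 1) h')
  exact image_eq_zero_of_notMem_tsupport (f := fun x => fderiv ℝ (fun y => fderiv ℝ u y
    (EuclideanSpace.single i 1)) x (EuclideanSpace.single i 1)) h2

lemma integral_mul_fderiv_eq_neg {u ψ : EuclideanSpace ℝ (Fin d) → ℝ}
    (hu : ContDiff ℝ (⊤ : ℕ∞) u) (hψ : ContDiff ℝ (⊤ : ℕ∞) ψ) (hc : HasCompactSupport ψ)
    (v : EuclideanSpace ℝ (Fin d)) :
    ∫ x, u x * fderiv ℝ ψ x v = -∫ x, fderiv ℝ u x v * ψ x := by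
  have hu' := (hu.fderiv_apply_const v).continuous
  have hψ' := (hψ.fderiv_apply_const v).continuous
  exact integral_mul_fderiv_eq_neg_fderiv_mul_of_integrable
    ((hu'.mul hψ.continuous).integrable_of_hasCompactSupport hc.mul_left)
    ((hu.continuous.mul hψ').integrable_of_hasCompactSupport (hc.fderiv_apply ℝ v).mul_left)
    ((hu.continuous.mul hψ.continuous).integrable_of_hasCompactSupport hc.mul_left)
    (fun x _ => hu.differentiable (by simp) x) (fun x _ => hψ.differentiable (by simp) x)

/-- The Laplacian is symmetric: Green's formula against a compactly supported function. -/
lemma integral_mul_laplacian {u ψ : EuclideanSpace ℝ (Fin d) → ℝ}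
    (hu : ContDiff ℝ (⊤ : ℕ∞) u) (hψ : ContDiff ℝ (⊤ : ℕ∞) ψ) (hc : HasCompactSupport ψ) :
    ∫ x, u x * laplacian ψ x = ∫ x, laplacian u x * ψ x := by
  simp only [laplacian, Finset.mul_sum, Finset.sum_mul]
  rw [integral_finsetSum, integral_finsetSum]
  · refine Finset.sum_congr rfl fun i _ => ?_
    rw [integral_mul_fderiv_eq_neg hu (hψ.fderiv_apply_const _) (hc.fderiv_apply ℝ _),
      integral_mul_fderiv_eq_neg (hu.fderiv_apply_const _) hψ hc, neg_neg]
  · intro i _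
    exact (((hu.fderiv_apply_const _).fderiv_apply_const _).continuous.mul
      hψ.continuous).integrable_of_hasCompactSupport hc.mul_left
  · intro i _
    exact (hu.continuous.mul
      ((hψ.fderiv_apply_const _).fderiv_apply_const _).continuous).integrable_of_hasCompactSupport
      ((hc.fderiv_apply ℝ _).fderiv_apply ℝ _).mul_left

/-! ### The regularized powers `(‖x‖² + ε)^a` -/

lemma contDiff_norm_sq_add_rpow {ε : ℝ} (hε : 0 < ε) (a : ℝ) :
    ContDiff ℝ (⊤ : ℕ∞) (fun x : EuclideanSpace ℝ (Fin d) => (‖x‖ ^ 2 + ε) ^ a) :=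
  ((contDiff_norm_sq ℝ).add contDiff_const).rpow_const_of_ne fun x => by positivity

lemma fderiv_norm_sq_add_rpow {ε : ℝ} (hε : 0 < ε) (a : ℝ)
    (x : EuclideanSpace ℝ (Fin d)) (i : Fin d) :
    fderiv ℝ (fun x : EuclideanSpace ℝ (Fin d) => (‖x‖ ^ 2 + ε) ^ a) x
      (EuclideanSpace.single i 1) = 2 * a * (‖x‖ ^ 2 + ε) ^ (a - 1) * x i := by
  have h : HasFDerivAt (fun x : EuclideanSpace ℝ (Fin d) => ‖x‖ ^ 2 + ε)
      (2 • innerSL ℝ x) x := (hasStrictFDerivAt_norm_sq x).hasFDerivAt.add_const ε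
  rw [(h.rpow_const (p := a) (Or.inl (by positivity))).fderiv]
  simp [EuclideanSpace.inner_single_right]
  ring

lemma laplacian_norm_sq_add_rpow {ε : ℝ} (hε : 0 < ε) (a : ℝ)
    (x : EuclideanSpace ℝ (Fin d)) :
    laplacian (fun x : EuclideanSpace ℝ (Fin d) => (‖x‖ ^ 2 + ε) ^ a) x =
      2 * a * (d + 2 * a - 2) * (‖x‖ ^ 2 + ε) ^ (a - 1) -
        4 * a * (a - 1) * (ε * (‖x‖ ^ 2 + ε) ^ (a - 1 - 1)) := by
  have hs : 0 < ‖x‖ ^ 2 + ε := by positivity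
  have key : ∀ i : Fin d, fderiv ℝ (fun y => fderiv ℝ
      (fun x : EuclideanSpace ℝ (Fin d) => (‖x‖ ^ 2 + ε) ^ a) y (EuclideanSpace.single i 1)) x
      (EuclideanSpace.single i 1) = 2 * a * (‖x‖ ^ 2 + ε) ^ (a - 1) +
        4 * a * (a - 1) * (‖x‖ ^ 2 + ε) ^ (a - 1 - 1) * x i ^ 2 := by
    intro i
    simp only [fderiv_norm_sq_add_rpow hε]
    have h1 := ((contDiff_norm_sq_add_rpow (d := d) hε (a - 1)).differentiable
      (by simp) x).hasFDerivAt.const_mul (2 * a)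
    have h2 : HasFDerivAt (fun y : EuclideanSpace ℝ (Fin d) => y i)
        (EuclideanSpace.proj i : EuclideanSpace ℝ (Fin d) →L[ℝ] ℝ) x :=
      (EuclideanSpace.proj i : EuclideanSpace ℝ (Fin d) →L[ℝ] ℝ).hasFDerivAt
    rw [(h1.fun_mul h2).fderiv]
    simp [fderiv_norm_sq_add_rpow hε]
    ring
  unfold laplacian
  simp only [key, Finset.sum_add_distrib, ← Finset.mul_sum, Finset.sum_const, Finset.card_univ,
    Fintype.card_fin, nsmul_eq_mul]
  have hn : ∑ i, x i ^ 2 = ‖x‖ ^ 2 := by simp [EuclideanSpace.norm_sq_eq]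
  have hp : (‖x‖ ^ 2 + ε) ^ (a - 1) = (‖x‖ ^ 2 + ε) ^ (a - 1 - 1) * (‖x‖ ^ 2 + ε) := by
    rw [← Real.rpow_add_one hs.ne']; ring_nf
  rw [hn, hp]
  ring

/-! ### Passage to the limit -/

lemma integrable_norm_rpow_mul [NeZero d] {p : ℝ} (hp : -d < p)
    {g : EuclideanSpace ℝ (Fin d) → ℝ} (hg : Continuous g) (hc : HasCompactSupport g) :
    Integrable (fun x => ‖x‖ ^ p * g x) := by
  obtain ⟨R, hR⟩ := hc.isCompact.isBounded.subset_ball (0 : EuclideanSpace ℝ (Fin d))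
  obtain ⟨C, hC⟩ := hc.exists_bound_of_continuous hg
  have h : IntegrableOn (fun x : EuclideanSpace ℝ (Fin d) => ‖x‖ ^ p) (Metric.ball 0 R) := by
    rw [integrableOn_fun_norm_addHaar volume (f := fun y : ℝ => y ^ p)]
    have h' : IntegrableOn (fun y : ℝ => y ^ (p + d - 1)) (Ioo 0 R) := by
      rcases le_total R 0 with hR0 | hR0
      · simp [Ioo_eq_empty_of_le hR0]
      rw [← integrableOn_Ioc_iff_integrableOn_Ioo,
        ← intervalIntegrable_iff_integrableOn_Ioc_of_le hR0]
      exact intervalIntegral.intervalIntegrable_rpow' (by linarith)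
    refine h'.congr_fun (fun y hy => ?_) measurableSet_Ioo
    have hd : 1 ≤ d := NeZero.one_le
    rw [finrank_euclideanSpace_fin, smul_eq_mul, ← Real.rpow_natCast, ← Real.rpow_add hy.1]
    push_cast [hd]
    ring_nf
  have h2 : IntegrableOn (fun x => ‖x‖ ^ p * g x) (Metric.ball 0 R) :=
    h.mul_bdd (c := C) hg.aestronglyMeasurable (Eventually.of_forall hC)
  refine (integrableOn_iff_integrable_of_support_subset fun x hx => hR (subset_tsupport _ ?_)).1 h2
  exact right_ne_zero_of_mul hx

lemma norm_sq_add_rpow_le {x : EuclideanSpace ℝ (Fin d)} (hx : x ≠ 0) (b : ℝ) {ε : ℝ}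
    (hε : 0 < ε) (hε1 : ε ≤ 1) :
    (‖x‖ ^ 2 + ε) ^ b ≤ ‖x‖ ^ (2 * b) + (‖x‖ ^ 2 + 1) ^ b := by
  have hx' : 0 < ‖x‖ := norm_pos_iff.2 hx
  rcases le_total 0 b with hb | hb
  · have : (‖x‖ ^ 2 + ε) ^ b ≤ (‖x‖ ^ 2 + 1) ^ b :=
      Real.rpow_le_rpow (by positivity) (by linarith) hb
    have : 0 ≤ ‖x‖ ^ (2 * b) := by positivity
    linarith
  · have : (‖x‖ ^ 2 + ε) ^ b ≤ (‖x‖ ^ 2) ^ b :=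
      Real.rpow_le_rpow_of_nonpos (by positivity) (by linarith) hb
    have h0 : 0 ≤ (‖x‖ ^ 2 + 1) ^ b := by positivity
    rw [Real.rpow_mul hx'.le, Real.rpow_two]
    linarith

lemma integrable_dominating [NeZero d] {b : ℝ} (hb : -d < 2 * b)
    {g : EuclideanSpace ℝ (Fin d) → ℝ} (hg : Continuous g) (hc : HasCompactSupport g) :
    Integrable (fun x => (‖x‖ ^ (2 * b) + (‖x‖ ^ 2 + 1) ^ b) * ‖g x‖) := by
  simp only [add_mul]
  exact (integrable_norm_rpow_mul hb hg.norm hc.norm).add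
    (((contDiff_norm_sq_add_rpow one_pos b).continuous.mul
      hg.norm).integrable_of_hasCompactSupport hc.norm.mul_left)

lemma tendsto_norm_sq_add_rpow {x : EuclideanSpace ℝ (Fin d)} (hx : x ≠ 0) (b : ℝ) :
    Tendsto (fun ε : ℝ => (‖x‖ ^ 2 + ε) ^ b) (𝓝[>] 0) (𝓝 (‖x‖ ^ (2 * b))) := by
  have hx' : 0 < ‖x‖ := norm_pos_iff.2 hx
  have h : ContinuousAt (fun ε : ℝ => (‖x‖ ^ 2 + ε) ^ b) 0 :=
    ContinuousAt.rpow_const (by fun_prop) (Or.inl (by positivity))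
  convert h.tendsto.mono_left nhdsWithin_le_nhds using 2
  rw [add_zero, ← Real.rpow_natCast, ← Real.rpow_mul hx'.le]
  norm_num

lemma eventually_mem_Ioc_zero_one : ∀ᶠ ε : ℝ in 𝓝[>] 0, 0 < ε ∧ ε ≤ 1 :=
  Ioc_mem_nhdsGT one_pos

lemma tendsto_integral_norm_sq_add_rpow_mul [NeZero d] {b : ℝ} (hb : -d < 2 * b)
    {g : EuclideanSpace ℝ (Fin d) → ℝ} (hg : Continuous g) (hc : HasCompactSupport g) :
    Tendsto (fun ε : ℝ => ∫ x, (‖x‖ ^ 2 + ε) ^ b * g x) (𝓝[>] 0)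
      (𝓝 (∫ x, ‖x‖ ^ (2 * b) * g x)) := by
  refine tendsto_integral_filter_of_dominated_convergence _ ?_ ?_ (integrable_dominating hb hg hc) ?_
  · filter_upwards [eventually_mem_Ioc_zero_one] with ε hε
    exact ((contDiff_norm_sq_add_rpow hε.1 b).continuous.mul hg).aestronglyMeasurable
  · filter_upwards [eventually_mem_Ioc_zero_one] with ε hε
    filter_upwards [Measure.ae_ne volume (0 : EuclideanSpace ℝ (Fin d))] with x hx
    have : 0 ≤ (‖x‖ ^ 2 + ε) ^ b := by have := hε.1; positivity
    rw [norm_mul, Real.norm_of_nonneg this]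
    gcongr
    exact norm_sq_add_rpow_le hx b hε.1 hε.2
  · filter_upwards [Measure.ae_ne volume (0 : EuclideanSpace ℝ (Fin d))] with x hx
    exact (tendsto_norm_sq_add_rpow hx b).mul_const _

lemma tendsto_integral_mul_norm_sq_add_rpow_sub_one_mul [NeZero d] {b : ℝ} (hb : -d < 2 * b)
    {g : EuclideanSpace ℝ (Fin d) → ℝ} (hg : Continuous g) (hc : HasCompactSupport g) :
    Tendsto (fun ε : ℝ => ∫ x, ε * (‖x‖ ^ 2 + ε) ^ (b - 1) * g x) (𝓝[>] 0) (𝓝 0) := by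
  suffices Tendsto (fun ε : ℝ => ∫ x, ε * (‖x‖ ^ 2 + ε) ^ (b - 1) * g x) (𝓝[>] 0)
      (𝓝 (∫ _ : EuclideanSpace ℝ (Fin d), 0)) by simpa using this
  refine tendsto_integral_filter_of_dominated_convergence _ ?_ ?_ (integrable_dominating hb hg hc) ?_
  · filter_upwards [eventually_mem_Ioc_zero_one] with ε hε
    exact ((continuous_const.mul (contDiff_norm_sq_add_rpow hε.1 (b - 1)).continuous).mul
      hg).aestronglyMeasurable
  · filter_upwards [eventually_mem_Ioc_zero_one] with ε hε
    filter_upwards [Measure.ae_ne volume (0 : EuclideanSpace ℝ (Fin d))] with x hx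
    have hε0 := hε.1
    have hs : 0 < ‖x‖ ^ 2 + ε := by positivity
    rw [norm_mul, Real.norm_of_nonneg (by positivity)]
    gcongr
    refine le_trans ?_ (norm_sq_add_rpow_le hx b hε.1 hε.2)
    calc ε * (‖x‖ ^ 2 + ε) ^ (b - 1) ≤ (‖x‖ ^ 2 + ε) * (‖x‖ ^ 2 + ε) ^ (b - 1) := by
          gcongr; nlinarith [sq_nonneg ‖x‖]
      _ = (‖x‖ ^ 2 + ε) ^ b := by
          rw [mul_comm, ← Real.rpow_add_one hs.ne']; ring_nf
  · filter_upwards [Measure.ae_ne volume (0 : EuclideanSpace ℝ (Fin d))] with x hx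
    have h0 : Tendsto (fun ε : ℝ => ε) (𝓝[>] 0) (𝓝 0) := nhdsWithin_le_nhds
    simpa using (h0.mul (tendsto_norm_sq_add_rpow hx (b - 1))).mul_const (g x)

/-- The regularized fundamental solution is an approximate identity. -/
lemma tendsto_integral_approx_identity {g : EuclideanSpace ℝ (Fin d) → ℝ} (hg : Continuous g)
    (hc : HasCompactSupport g) :
    Tendsto (fun ε : ℝ => ∫ x, ε * (‖x‖ ^ 2 + ε) ^ (-(d + 2 : ℝ) / 2) * g x) (𝓝[>] 0)
      (𝓝 ((∫ y : EuclideanSpace ℝ (Fin d), (1 + ‖y‖ ^ 2) ^ (-(d + 2 : ℝ) / 2)) * g 0)) := by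
  have hint : Integrable
      (fun y : EuclideanSpace ℝ (Fin d) => ((1 : ℝ) + ‖y‖ ^ 2) ^ (-(d + 2 : ℝ) / 2)) :=
    integrable_rpow_neg_one_add_norm_sq (by simp)
  obtain ⟨C, hC⟩ := hc.exists_bound_of_continuous hg
  have key : Tendsto (fun ε : ℝ => ∫ y : EuclideanSpace ℝ (Fin d),
      (1 + ‖y‖ ^ 2) ^ (-(d + 2 : ℝ) / 2) * g (√ε • y)) (𝓝[>] 0)
      (𝓝 (∫ y : EuclideanSpace ℝ (Fin d), (1 + ‖y‖ ^ 2) ^ (-(d + 2 : ℝ) / 2) * g 0)) := by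
    refine tendsto_integral_filter_of_dominated_convergence
      (fun y => (1 + ‖y‖ ^ 2) ^ (-(d + 2 : ℝ) / 2) * C) ?_ ?_ (hint.mul_const C) ?_
    · refine Eventually.of_forall fun ε => hint.aestronglyMeasurable.mul ?_
      exact (hg.comp (continuous_const_smul _)).aestronglyMeasurable
    · refine Eventually.of_forall fun ε => Eventually.of_forall fun y => ?_
      rw [norm_mul, Real.norm_of_nonneg (by positivity)]
      gcongr
      exact hC _
    · refine Eventually.of_forall fun y => Tendsto.const_mul _ ?_
      have h : Continuous fun ε : ℝ => g (√ε • y) := by fun_prop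
      simpa using (h.tendsto 0).mono_left nhdsWithin_le_nhds
  rw [integral_mul_const] at key
  refine key.congr' ?_
  filter_upwards [self_mem_nhdsWithin] with ε (hε : 0 < ε)
  have h := Measure.integral_comp_smul_of_nonneg (volume : Measure (EuclideanSpace ℝ (Fin d)))
    (fun x => ε * (‖x‖ ^ 2 + ε) ^ (-(d + 2 : ℝ) / 2) * g x) √ε (hR := Real.sqrt_nonneg ε)
  have hpos : 0 < √ε ^ d := by positivity
  rw [finrank_euclideanSpace_fin, smul_eq_mul, eq_inv_mul_iff_mul_eq₀ hpos.ne',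
    ← integral_const_mul] at h
  rw [← h]
  refine integral_congr_ae (Eventually.of_forall fun y => ?_)
  have h1 : ‖√ε • y‖ ^ 2 + ε = ε * (1 + ‖y‖ ^ 2) := by
    rw [norm_smul, mul_pow, Real.norm_of_nonneg (Real.sqrt_nonneg ε), Real.sq_sqrt hε.le]; ring
  have h2 : √ε ^ d * (ε * ε ^ (-(d + 2 : ℝ) / 2)) = 1 := by
    rw [Real.sqrt_eq_rpow, ← Real.rpow_natCast, ← Real.rpow_mul hε.le, mul_comm ε,
      ← Real.rpow_add_one hε.ne', ← Real.rpow_add hε]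
    convert Real.rpow_zero ε using 2
    ring
  simp only [h1]
  rw [Real.mul_rpow hε.le (by positivity)]
  linear_combination (-(1 + ‖y‖ ^ 2) ^ (-(d + 2 : ℝ) / 2) * g (√ε • y)) * h2

lemma integral_one_add_norm_sq_rpow_pos :
    0 < ∫ y : EuclideanSpace ℝ (Fin d), (1 + ‖y‖ ^ 2) ^ (-(d + 2 : ℝ) / 2) := by
  have hint : Integrable
      (fun y : EuclideanSpace ℝ (Fin d) => ((1 : ℝ) + ‖y‖ ^ 2) ^ (-(d + 2 : ℝ) / 2)) :=
    integrable_rpow_neg_one_add_norm_sq (by simp)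
  refine (integral_pos_iff_support_of_nonneg (fun y => by positivity) hint).2 ?_
  have : Function.support (fun y : EuclideanSpace ℝ (Fin d) =>
      ((1 : ℝ) + ‖y‖ ^ 2) ^ (-(d + 2 : ℝ) / 2)) = univ :=
    eq_univ_of_forall fun y => (by positivity : (0 : ℝ) < _).ne'
  rw [this]
  exact Measure.measure_univ_pos.2 (NeZero.ne _)

/-! ### Powers of the norm against the Laplacian -/

lemma integral_norm_sq_add_rpow_mul_laplacian {ε : ℝ} (hε : 0 < ε) (a : ℝ)
    {ψ : EuclideanSpace ℝ (Fin d) → ℝ} (hψ : ContDiff ℝ (⊤ : ℕ∞) ψ) (hc : HasCompactSupport ψ) :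
    ∫ x, (‖x‖ ^ 2 + ε) ^ a * laplacian ψ x =
      2 * a * (d + 2 * a - 2) * (∫ x, (‖x‖ ^ 2 + ε) ^ (a - 1) * ψ x) -
        4 * a * (a - 1) * ∫ x, ε * (‖x‖ ^ 2 + ε) ^ (a - 1 - 1) * ψ x := by
  rw [integral_mul_laplacian (contDiff_norm_sq_add_rpow hε a) hψ hc, ← integral_const_mul,
    ← integral_const_mul, ← integral_sub]
  · simp only [laplacian_norm_sq_add_rpow hε]
    congr 1 with x
    ring
  · exact (((contDiff_norm_sq_add_rpow hε (a - 1)).continuous.mul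
      hψ.continuous).integrable_of_hasCompactSupport hc.mul_left).const_mul _
  · exact (((continuous_const.mul (contDiff_norm_sq_add_rpow hε (a - 1 - 1)).continuous).mul
      hψ.continuous).integrable_of_hasCompactSupport hc.mul_left).const_mul _

/-- Away from the critical exponent, `Δ ‖x‖^{2a} = 2a(d + 2a - 2) ‖x‖^{2(a-1)}` weakly. -/
lemma integral_norm_rpow_mul_laplacian [NeZero d] {a : ℝ} (ha : -d < 2 * (a - 1))
    {ψ : EuclideanSpace ℝ (Fin d) → ℝ} (hψ : ContDiff ℝ (⊤ : ℕ∞) ψ) (hc : HasCompactSupport ψ) :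
    ∫ x, ‖x‖ ^ (2 * a) * laplacian ψ x =
      2 * a * (d + 2 * a - 2) * ∫ x, ‖x‖ ^ (2 * (a - 1)) * ψ x := by
  have h1 := tendsto_integral_norm_sq_add_rpow_mul (b := a) (by linarith)
    hψ.laplacian.continuous hc.laplacian
  have h2 := ((tendsto_integral_norm_sq_add_rpow_mul ha hψ.continuous hc).const_mul
    (2 * a * (d + 2 * a - 2))).sub ((tendsto_integral_mul_norm_sq_add_rpow_sub_one_mul ha
      hψ.continuous hc).const_mul (4 * a * (a - 1)))
  rw [mul_zero, sub_zero] at h2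
  refine tendsto_nhds_unique h1 (h2.congr' ?_)
  filter_upwards [self_mem_nhdsWithin] with ε hε
  exact (integral_norm_sq_add_rpow_mul_laplacian hε a hψ hc).symm

/-- At the critical exponent, `‖x‖^{2-d}` is a multiple of the Newtonian potential. -/
lemma integral_newtonian_mul_laplacian [NeZero d]
    {ψ : EuclideanSpace ℝ (Fin d) → ℝ} (hψ : ContDiff ℝ (⊤ : ℕ∞) ψ) (hc : HasCompactSupport ψ) :
    ∫ x, ‖x‖ ^ (2 - d : ℝ) * laplacian ψ x =
      d * (2 - d) * (∫ y : EuclideanSpace ℝ (Fin d), (1 + ‖y‖ ^ 2) ^ (-(d + 2 : ℝ) / 2)) * ψ 0 := by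
  have h1 := tendsto_integral_norm_sq_add_rpow_mul (b := 1 - d / 2) (by linarith)
    hψ.laplacian.continuous hc.laplacian
  have h2 := (tendsto_integral_approx_identity hψ.continuous hc).const_mul (d * (2 - d) : ℝ)
  rw [show 2 * (1 - d / 2 : ℝ) = 2 - d by ring] at h1
  rw [mul_assoc]
  refine tendsto_nhds_unique h1 (h2.congr' ?_)
  filter_upwards [self_mem_nhdsWithin] with ε hε
  rw [integral_norm_sq_add_rpow_mul_laplacian hε _ hψ hc,
    show (1 - d / 2 - 1 - 1 : ℝ) = -(d + 2 : ℝ) / 2 by ring]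
  ring

lemma contDiff_laplacian_iterate {ψ : EuclideanSpace ℝ (Fin d) → ℝ}
    (hψ : ContDiff ℝ (⊤ : ℕ∞) ψ) (k : ℕ) : ContDiff ℝ (⊤ : ℕ∞) (laplacian^[k] ψ) := by
  induction k with
  | zero => exact hψ
  | succ k ih => rw [Function.iterate_succ_apply']; exact ih.laplacian

lemma hasCompactSupport_laplacian_iterate {ψ : EuclideanSpace ℝ (Fin d) → ℝ}
    (hc : HasCompactSupport ψ) (k : ℕ) : HasCompactSupport (laplacian^[k] ψ) := by
  induction k with
  | zero => exact hc
  | succ k ih => rw [Function.iterate_succ_apply']; exact ih.laplacian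

/-- For odd `d`, the function `‖x‖^{2k-d}` with `k ≥ 1` is a fundamental solution of `Δ^k` up to a
nonzero constant; this includes the singular range `2k < d`. -/
lemma exists_integral_norm_rpow_mul_laplacian_iterate (hodd : Odd d) (k : ℕ) :
    ∃ c : ℝ, c ≠ 0 ∧ ∀ ψ : EuclideanSpace ℝ (Fin d) → ℝ,
      ContDiff ℝ (⊤ : ℕ∞) ψ → HasCompactSupport ψ →
      ∫ x, ‖x‖ ^ (2 * ((k + 1 : ℕ) : ℝ) - d) * laplacian^[k + 1] ψ x = c * ψ 0 := by
  have : NeZero d := ⟨hodd.pos.ne'⟩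
  have hne : ∀ n : ℕ, (2 * n - d : ℝ) ≠ 0 := fun n h => by
    have : 2 * n = d := by exact_mod_cast sub_eq_zero.1 h
    exact Nat.not_even_iff_odd.2 hodd ⟨n, by omega⟩
  have hd : (d : ℝ) ≠ 0 := NeZero.ne _
  induction k with
  | zero =>
    refine ⟨_, mul_ne_zero (mul_ne_zero hd (by simpa using hne 1))
      (integral_one_add_norm_sq_rpow_pos (d := d)).ne', fun ψ hψ hc => ?_⟩
    simpa using integral_newtonian_mul_laplacian hψ hc
  | succ k ih =>
    obtain ⟨c, hc0, h⟩ := ih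
    refine ⟨(2 * ((k + 2 : ℕ) : ℝ) - d) * (2 * (k + 1)) * c,
      mul_ne_zero (mul_ne_zero (hne _) (by positivity)) hc0, fun ψ hψ hc => ?_⟩
    have h' := integral_norm_rpow_mul_laplacian (a := (k + 2 : ℕ) - d / 2)
      (by push_cast; linarith [k.cast_nonneg (α := ℝ)])
      (contDiff_laplacian_iterate hψ (k + 1)) (hasCompactSupport_laplacian_iterate hc (k + 1))
    rw [← Function.iterate_succ_apply' laplacian (k + 1) ψ] at h'
    rw [show 2 * (((k + 2 : ℕ) : ℝ) - d / 2) = 2 * ((k + 1 + 1 : ℕ) : ℝ) - d by push_cast; ring,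
      show 2 * (((k + 2 : ℕ) : ℝ) - d / 2 - 1) = 2 * ((k + 1 : ℕ) : ℝ) - d by push_cast; ring,
      h ψ hψ hc] at h'
    rw [h']
    push_cast
    ring

end SurfaceSpline

/-- For odd `d ≥ 1` and `m > d/2`, there is a nonzero constant `c` such that
`∫ ‖x‖^{2m-d} (Δ^m ψ)(x) dx = c ψ(0)` for every smooth compactly supported `ψ`;
i.e. `‖·‖^{2m-d}` is, up to the constant `c`, a fundamental solution of `Δ^m`. -/
theorem surfSpline_odd_fundamental_solution (m d : ℕ) (hodd : Odd d) (hd : 1 ≤ d)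
    (hm : d < 2 * m) :
    ∃ c : ℝ, c ≠ 0 ∧ ∀ ψ : EuclideanSpace ℝ (Fin d) → ℝ,
      ContDiff ℝ (⊤ : ℕ∞) ψ → HasCompactSupport ψ →
      ∫ x, ‖x‖ ^ (2 * (m : ℝ) - d) * (laplacian (d := d))^[m] ψ x = c * ψ 0 := by
  obtain ⟨k, rfl⟩ : ∃ k, m = k + 1 := ⟨m - 1, by omega⟩
  exact exists_integral_norm_rpow_mul_laplacian_iterate hodd k
end

section
/- Let m, d be integers with m > d/2, and let φ = φ_{m,d} be the surface spline fundamental solution. For every natural number n with n ≤ 2m − d, there exists a constant C > 0 such that for all x ∈ ℝ^d with x ≠ 0, the norm of the n-th total derivative of φ at x satisfies ‖D^n φ(x)‖ ≤ C · ‖x‖^{2m−d−n} · (1 + |log‖x‖|). -/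
open MeasureTheory

/-- The surface spline `φ_{m,d}`, the fundamental solution (up to a constant, here
normalized to 1) of the `m`-fold Laplacian on `ℝ^d`:
`‖x‖^{2m-d} log‖x‖` for even `d`, and `‖x‖^{2m-d}` for odd `d` (vanishing at `0`). -/
noncomputable def surfSpline (m d : ℕ) (x : EuclideanSpace ℝ (Fin d)) : ℝ :=
  if Even d then ‖x‖ ^ (2 * (m : ℝ) - d) * Real.log ‖x‖ else ‖x‖ ^ (2 * (m : ℝ) - d)

/-- Scaling rule for iterated derivatives; no regularity is needed since scaling is invertible. -/
lemma iteratedFDeriv_comp_const_smul_of_ne_zero {E F : Type*} [NormedAddCommGroup E]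
    [NormedSpace ℝ E] [NormedAddCommGroup F] [NormedSpace ℝ F] (f : E → F) {t : ℝ} (ht : t ≠ 0)
    (n : ℕ) (x : E) :
    iteratedFDeriv ℝ n (fun y ↦ f (t • y)) x = t ^ n • iteratedFDeriv ℝ n f (t • x) := by
  have h := (ContinuousLinearEquiv.smulLeft (R₁ := ℝ) (M₁ := E)
    (Units.mk0 t ht)).iteratedFDerivWithin_comp_right f (s := Set.univ) uniqueDiffOn_univ
      (x := x) (Set.mem_univ _) n
  rw [Set.preimage_univ, iteratedFDerivWithin_univ, iteratedFDerivWithin_univ] at h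
  ext v
  have hv := congrArg (fun A ↦ A v) h
  have hs := (iteratedFDeriv ℝ n f (t • x)).map_smul_univ (fun _ ↦ t) v
  rw [Finset.prod_const, Finset.card_univ, Fintype.card_fin] at hs
  exact hv.trans hs

/-- Derivative bounds for a function which is homogeneous up to a logarithmic correction. -/
lemma exists_norm_iteratedFDeriv_le_of_log_homogeneous {E F : Type*} [NormedAddCommGroup E]
    [NormedSpace ℝ E] [ProperSpace E] [NormedAddCommGroup F] [NormedSpace ℝ F] {f g : E → F}
    {a : ℝ} {n : ℕ} (hf : ∀ x ≠ 0, ContDiffAt ℝ n f x) (hg : ∀ x ≠ 0, ContDiffAt ℝ n g x)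
    (hfg : ∀ t : ℝ, 0 < t → ∀ x ≠ 0, g (t • x) = t ^ a • (g x + Real.log t • f x)) :
    ∃ C > 0, ∀ x ≠ 0,
      ‖iteratedFDeriv ℝ n g x‖ ≤ C * ‖x‖ ^ (a - n) * (1 + |Real.log ‖x‖|) := by
  have bdd : ∀ h : E → F, (∀ x ≠ 0, ContDiffAt ℝ n h x) →
      ∃ C, ∀ u ∈ Metric.sphere (0 : E) 1, ‖iteratedFDeriv ℝ n h u‖ ≤ C := fun h hh ↦
    (isCompact_sphere (0 : E) 1).exists_bound_of_continuousOn fun u hu ↦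
      ((hh u (ne_zero_of_mem_unit_sphere ⟨u, hu⟩)).continuousAt_iteratedFDeriv
        le_rfl).continuousWithinAt
  obtain ⟨A, hA⟩ := bdd f hf
  obtain ⟨B, hB⟩ := bdd g hg
  refine ⟨max 1 (max A B), by positivity, fun x hx ↦ ?_⟩
  set C := max 1 (max A B)
  have ht : 0 < ‖x‖ := norm_pos_iff.mpr hx
  set t := ‖x‖ with ht_def
  set u := t⁻¹ • x with hu_def
  have hxu : t • u = x := smul_inv_smul₀ ht.ne' x
  have hu : u ∈ Metric.sphere (0 : E) 1 := by
    rw [mem_sphere_zero_iff_norm, hu_def, norm_smul, norm_inv, Real.norm_of_nonneg ht.le,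
      ← ht_def, inv_mul_cancel₀ ht.ne']
  have hu0 : u ≠ 0 := smul_ne_zero (inv_ne_zero ht.ne') hx
  have hscale : t ^ n • iteratedFDeriv ℝ n g x =
      t ^ a • (iteratedFDeriv ℝ n g u + Real.log t • iteratedFDeriv ℝ n f u) := by
    have hev : (fun y ↦ g (t • y)) =ᶠ[nhds u] t ^ a • (g + Real.log t • f) := by
      filter_upwards [isOpen_ne.mem_nhds hu0] with y hy using hfg t ht y hy
    have hlog : ContDiffAt ℝ n (Real.log t • f) u := contDiffAt_const.smul (hf u hu0)
    have hsum : ContDiffAt ℝ n (g + Real.log t • f) u := (hg u hu0).add hlog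
    rw [← iteratedFDeriv_const_smul_apply (hf u hu0),
      ← iteratedFDeriv_add_apply (hg u hu0) hlog,
      ← iteratedFDeriv_const_smul_apply hsum, ← (hev.iteratedFDeriv ℝ n).eq_of_nhds,
      iteratedFDeriv_comp_const_smul_of_ne_zero g ht.ne', hxu]
  have hnorm := congrArg norm hscale
  rw [norm_smul, norm_smul, Real.norm_of_nonneg (by positivity : 0 ≤ t ^ n),
    Real.norm_of_nonneg (Real.rpow_nonneg ht.le a)] at hnorm
  have hbound : ‖iteratedFDeriv ℝ n g u + Real.log t • iteratedFDeriv ℝ n f u‖ ≤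
      C * (1 + |Real.log t|) := calc
    _ ≤ ‖iteratedFDeriv ℝ n g u‖ + |Real.log t| * ‖iteratedFDeriv ℝ n f u‖ :=
      (norm_add_le _ _).trans_eq (by rw [norm_smul, Real.norm_eq_abs])
    _ ≤ C + |Real.log t| * C := by
      gcongr
      · exact (hB u hu).trans ((le_max_right A B).trans (le_max_right _ _))
      · exact (hA u hu).trans ((le_max_left A B).trans (le_max_right _ _))
    _ = C * (1 + |Real.log t|) := by ring
  refine le_of_mul_le_mul_left ?_ (by positivity : 0 < t ^ n)
  rw [hnorm, Real.rpow_sub ht, Real.rpow_natCast]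
  calc t ^ a * ‖iteratedFDeriv ℝ n g u + Real.log t • iteratedFDeriv ℝ n f u‖
      ≤ t ^ a * (C * (1 + |Real.log t|)) := by gcongr
    _ = t ^ n * (C * (t ^ a / t ^ n) * (1 + |Real.log t|)) := by field_simp

/-- Derivative estimates for the surface spline, low-order case: for `n ≤ 2m - d`,
`‖D^n φ_{m,d}(x)‖ ≤ C ‖x‖^{2m-d-n} (1 + |log‖x‖|)` for all `x ≠ 0`. -/
theorem surfSpline_iteratedFDeriv_bound_low (m d : ℕ) (hd : 1 ≤ d) (hm : d < 2 * m)
    (n : ℕ) (hn : (n : ℤ) ≤ 2 * (m : ℤ) - d) :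
    ∃ C > 0, ∀ x : EuclideanSpace ℝ (Fin d), x ≠ 0 →
      ‖iteratedFDeriv ℝ n (surfSpline m d) x‖
        ≤ C * ‖x‖ ^ (2 * (m : ℝ) - d - n) * (1 + |Real.log ‖x‖|) := by
  have hpow : ∀ x : EuclideanSpace ℝ (Fin d), x ≠ 0 →
      ContDiffAt ℝ n (fun y : EuclideanSpace ℝ (Fin d) ↦ ‖y‖ ^ (2 * (m : ℝ) - d)) x :=
    fun x hx ↦ (contDiffAt_norm ℝ hx).rpow_const_of_ne (norm_ne_zero_iff.mpr hx)
  by_cases h : Even d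
  · have hφ : surfSpline m d = fun x ↦ ‖x‖ ^ (2 * (m : ℝ) - d) * Real.log ‖x‖ :=
      funext fun x ↦ if_pos h
    rw [hφ]
    refine exists_norm_iteratedFDeriv_le_of_log_homogeneous hpow
      (fun x hx ↦ (hpow x hx).mul ((contDiffAt_norm ℝ hx).log (norm_ne_zero_iff.mpr hx)))
      fun t ht x hx ↦ ?_
    rw [norm_smul, Real.norm_of_nonneg ht.le, Real.mul_rpow ht.le (norm_nonneg x),
      Real.log_mul ht.ne' (norm_ne_zero_iff.mpr hx), smul_eq_mul, smul_eq_mul]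
    ring
  · have hφ : surfSpline m d = fun x ↦ ‖x‖ ^ (2 * (m : ℝ) - d) := funext fun x ↦ if_neg h
    rw [hφ]
    refine exists_norm_iteratedFDeriv_le_of_log_homogeneous (f := fun _ ↦ 0)
      (fun _ _ ↦ contDiffAt_const) hpow fun t ht x hx ↦ ?_
    rw [norm_smul, Real.norm_of_nonneg ht.le, Real.mul_rpow ht.le (norm_nonneg x), smul_zero,
      add_zero, smul_eq_mul]
end

section
/- (Lemma 2.1) Let m, d be integers with m > d/2, let φ = φ_{m,d} be the surface spline fundamental solution, and let L be an integer with L ≥ 2m − d. Let μ be a compactly supported finite signed measure on ℝ^d which annihilates all polynomials of total degree at most L, i.e., ∫ p dμ = 0 for every polynomial p in d variables with total degree ≤ L. Then there exists a constant C (depending on μ, m, d, L) such that for all x ∈ ℝ^d, |∫ φ(x − α) dμ(α)| ≤ C · (1 + ‖x‖)^{2m−d−L−1}. -/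
open MeasureTheory

/-- Functions on `ℝ^d` given by a polynomial of total degree at most `n`. -/
def IsPolyFun {d : ℕ} (n : ℕ) (f : EuclideanSpace ℝ (Fin d) → ℝ) : Prop :=
  ∃ p : MvPolynomial (Fin d) ℝ, p.totalDegree ≤ n ∧
    ∀ α : EuclideanSpace ℝ (Fin d), MvPolynomial.eval (fun i => α i) p = f α

namespace IsPolyFun

variable {d : ℕ} {n k : ℕ} {f g : EuclideanSpace ℝ (Fin d) → ℝ}

lemma mono (hf : IsPolyFun n f) (h : n ≤ k) : IsPolyFun k f :=
  let ⟨p, hp, hpf⟩ := hf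
  ⟨p, hp.trans h, hpf⟩

lemma const (c : ℝ) : IsPolyFun n (fun _ : EuclideanSpace ℝ (Fin d) => c) :=
  ⟨MvPolynomial.C c, by simp, by simp⟩

lemma coord (i : Fin d) : IsPolyFun 1 (fun α : EuclideanSpace ℝ (Fin d) => α i) :=
  ⟨MvPolynomial.X i, by simp, by simp⟩

lemma add (hf : IsPolyFun n f) (hg : IsPolyFun n g) : IsPolyFun n (fun α => f α + g α) := by
  obtain ⟨p, hp, hpf⟩ := hf
  obtain ⟨q, hq, hqg⟩ := hg
  exact ⟨p + q, (MvPolynomial.totalDegree_add p q).trans (max_le hp hq), by simp [hpf, hqg]⟩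

lemma mul (hf : IsPolyFun n f) (hg : IsPolyFun k g) :
    IsPolyFun (n + k) (fun α => f α * g α) := by
  obtain ⟨p, hp, hpf⟩ := hf
  obtain ⟨q, hq, hqg⟩ := hg
  exact ⟨p * q, (MvPolynomial.totalDegree_mul p q).trans (add_le_add hp hq),
    by simp [hpf, hqg]⟩

lemma const_mul (c : ℝ) (hf : IsPolyFun n f) : IsPolyFun n (fun α => c * f α) := by
  simpa using (const (n := 0) c).mul hf

lemma pow (hf : IsPolyFun n f) (j : ℕ) : IsPolyFun (j * n) (fun α => f α ^ j) := by
  obtain ⟨p, hp, hpf⟩ := hf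
  exact ⟨p ^ j, (MvPolynomial.totalDegree_pow p j).trans (Nat.mul_le_mul_left j hp),
    by simp [hpf]⟩

lemma sum {ι : Type*} (s : Finset ι) {F : ι → EuclideanSpace ℝ (Fin d) → ℝ}
    (h : ∀ i ∈ s, IsPolyFun n (F i)) : IsPolyFun n (fun α => ∑ i ∈ s, F i α) := by
  classical
  induction s using Finset.induction_on with
  | empty => simpa using const 0
  | insert i s hi ih =>
    simp only [Finset.sum_insert hi]
    exact (h i (by simp)).add (ih fun j hj => h j (by simp [hj]))

lemma normSq : IsPolyFun 2 (fun α : EuclideanSpace ℝ (Fin d) => ‖α‖ ^ 2) := by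
  simp only [EuclideanSpace.real_norm_sq_eq]
  exact sum _ fun i _ => by simpa using (coord i).pow 2

lemma inner_left (x : EuclideanSpace ℝ (Fin d)) :
    IsPolyFun 1 (fun α : EuclideanSpace ℝ (Fin d) => inner ℝ x α) := by
  simp only [PiLp.inner_apply]
  exact sum _ fun i _ => by simpa [mul_comm] using (coord i).const_mul (x i)

lemma continuous (hf : IsPolyFun n f) : Continuous f := by
  obtain ⟨p, -, hp⟩ := hf
  rw [← funext hp]
  exact (MvPolynomial.continuous_eval p).comp (by fun_prop)

lemma normSq_sub (x : EuclideanSpace ℝ (Fin d)) :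
    IsPolyFun 2 (fun α : EuclideanSpace ℝ (Fin d) => ‖x - α‖ ^ 2) := by
  have h : (fun α : EuclideanSpace ℝ (Fin d) => ‖x - α‖ ^ 2)
      = fun α => (‖x‖ ^ 2 + (-2) * inner ℝ x α) + ‖α‖ ^ 2 := by
    ext α
    rw [norm_sub_sq_real]
    ring
  rw [h]
  exact ((const _).add (((inner_left x).const_mul _).mono (by norm_num))).add normSq

end IsPolyFun

/-- The terms of `∑ j ≤ L, c j * (a + b) ^ j` of weighted degree at most `L`, where `a` has
weight `2` and `b` has weight `1`. -/
def weightedTaylor (c : ℕ → ℝ) (L : ℕ) (a b : ℝ) : ℝ :=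
  ∑ j ∈ Finset.range (L + 1), ∑ i ∈ Finset.range (j + 1),
    if i + j ≤ L then c j * (j.choose i : ℝ) * (a ^ i * b ^ (j - i)) else 0

lemma isPolyFun_weightedTaylor {d : ℕ} (c : ℕ → ℝ) (L : ℕ)
    {a b : EuclideanSpace ℝ (Fin d) → ℝ} (ha : IsPolyFun 2 a) (hb : IsPolyFun 1 b) :
    IsPolyFun L (fun α => weightedTaylor c L (a α) (b α)) := by
  refine IsPolyFun.sum _ fun j _ => IsPolyFun.sum _ fun i hi => ?_
  have hij : i ≤ j := Nat.lt_succ_iff.mp (Finset.mem_range.mp hi)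
  split_ifs with h
  · exact (((ha.pow i).mul (hb.pow (j - i))).const_mul _).mono (by omega)
  · exact IsPolyFun.const 0

lemma exists_abs_sum_sub_weightedTaylor_le (c : ℕ → ℝ) (L : ℕ) :
    ∃ C : ℝ, 0 ≤ C ∧ ∀ t a b : ℝ, 0 ≤ t → t ≤ 1 → |a| ≤ t ^ 2 → |b| ≤ 2 * t →
      |∑ j ∈ Finset.range (L + 1), c j * (a + b) ^ j - weightedTaylor c L a b|
        ≤ C * t ^ (L + 1) := by
  refine ⟨∑ j ∈ Finset.range (L + 1), ∑ i ∈ Finset.range (j + 1),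
    |c j| * (j.choose i : ℝ) * 2 ^ (j - i), by positivity, fun t a b ht ht1 ha hb => ?_⟩
  rw [weightedTaylor, ← Finset.sum_sub_distrib, Finset.sum_mul]
  refine (Finset.abs_sum_le_sum_abs _ _).trans (Finset.sum_le_sum fun j _ => ?_)
  rw [add_pow, Finset.mul_sum, ← Finset.sum_sub_distrib, Finset.sum_mul]
  refine (Finset.abs_sum_le_sum_abs _ _).trans (Finset.sum_le_sum fun i hi => ?_)
  have hij : i ≤ j := Nat.lt_succ_iff.mp (Finset.mem_range.mp hi)
  split_ifs with h
  · rw [show c j * (a ^ i * b ^ (j - i) * (j.choose i : ℝ))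
      - c j * (j.choose i : ℝ) * (a ^ i * b ^ (j - i)) = 0 by ring, abs_zero]
    positivity
  · have hab : |a| ^ i * |b| ^ (j - i) ≤ 2 ^ (j - i) * t ^ (L + 1) := calc
      |a| ^ i * |b| ^ (j - i) ≤ (t ^ 2) ^ i * (2 * t) ^ (j - i) := by gcongr
      _ = 2 ^ (j - i) * t ^ (2 * i + (j - i)) := by rw [mul_pow, pow_add, pow_mul]; ring
      _ ≤ 2 ^ (j - i) * t ^ (L + 1) := by
        gcongr 2 ^ (j - i) * ?_
        exact pow_le_pow_of_le_one ht ht1 (by omega)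
    rw [sub_zero, abs_mul, abs_mul, abs_mul, abs_pow, abs_pow, Nat.abs_cast]
    calc |c j| * (|a| ^ i * |b| ^ (j - i) * (j.choose i : ℝ))
        = |c j| * (j.choose i : ℝ) * (|a| ^ i * |b| ^ (j - i)) := by ring
      _ ≤ |c j| * (j.choose i : ℝ) * (2 ^ (j - i) * t ^ (L + 1)) := by gcongr
      _ = |c j| * (j.choose i : ℝ) * 2 ^ (j - i) * t ^ (L + 1) := by ring

lemma AnalyticAt.exists_abs_sub_sum_le {g : ℝ → ℝ} (hg : AnalyticAt ℝ g 0) (L : ℕ) :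
    ∃ (c : ℕ → ℝ) (A δ : ℝ), 0 ≤ A ∧ 0 < δ ∧ ∀ s : ℝ, |s| < δ →
      |g s - ∑ j ∈ Finset.range (L + 1), c j * s ^ j| ≤ A * |s| ^ (L + 1) := by
  obtain ⟨p, hp⟩ := hg
  obtain ⟨A, hA, hAb⟩ := (hp.isBigO_sub_partialSum_pow (L + 1)).exists_nonneg
  obtain ⟨δ, hδ, hb⟩ := Metric.eventually_nhds_iff.mp hAb.bound
  refine ⟨p.coeff, A, δ, hA, hδ, fun s hs => ?_⟩
  have := hb (y := s) (by simpa [Real.dist_eq] using hs)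
  simpa [FormalMultilinearSeries.partialSum, mul_comm] using this

lemma AnalyticAt.exists_abs_sub_weightedTaylor_le {g : ℝ → ℝ} (hg : AnalyticAt ℝ g 0) (L : ℕ) :
    ∃ (c : ℕ → ℝ) (C δ : ℝ), 0 ≤ C ∧ 0 < δ ∧ ∀ t a b : ℝ, 0 ≤ t → t ≤ δ →
      |a| ≤ t ^ 2 → |b| ≤ 2 * t →
      |g (a + b) - weightedTaylor c L a b| ≤ C * t ^ (L + 1) := by
  obtain ⟨c, A, δ, hA, hδ, h⟩ := hg.exists_abs_sub_sum_le L
  obtain ⟨C, hC, hCb⟩ := exists_abs_sum_sub_weightedTaylor_le c L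
  refine ⟨c, A * 3 ^ (L + 1) + C, min 1 (δ / 4), by positivity, by positivity,
    fun t a b ht htδ ha hb => ?_⟩
  have ht1 : t ≤ 1 := htδ.trans (min_le_left _ _)
  have ht2 : t ≤ δ / 4 := htδ.trans (min_le_right _ _)
  have hs : |a + b| ≤ 3 * t := by
    refine (abs_add_le a b).trans ?_
    nlinarith
  have h1 : |g (a + b) - ∑ j ∈ Finset.range (L + 1), c j * (a + b) ^ j|
      ≤ A * (3 * t) ^ (L + 1) :=
    (h (a + b) (by linarith)).trans (by gcongr)
  calc |g (a + b) - weightedTaylor c L a b|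
      ≤ |g (a + b) - ∑ j ∈ Finset.range (L + 1), c j * (a + b) ^ j|
        + |∑ j ∈ Finset.range (L + 1), c j * (a + b) ^ j - weightedTaylor c L a b| :=
        abs_sub_le _ _ _
    _ ≤ A * (3 * t) ^ (L + 1) + C * t ^ (L + 1) := add_le_add h1 (hCb t a b ht ht1 ha hb)
    _ = (A * 3 ^ (L + 1) + C) * t ^ (L + 1) := by rw [mul_pow]; ring

lemma abs_integral_sub_integral_le {d L : ℕ} {μ₁ μ₂ : Measure (EuclideanSpace ℝ (Fin d))}
    [IsFiniteMeasure μ₁] [IsFiniteMeasure μ₂]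
    {K : Set (EuclideanSpace ℝ (Fin d))} (hK : IsCompact K)
    (hμ₁ : μ₁ Kᶜ = 0) (hμ₂ : μ₂ Kᶜ = 0)
    (hann : ∀ p : MvPolynomial (Fin d) ℝ, p.totalDegree ≤ L →
      ∫ α, MvPolynomial.eval (fun i => α i) p ∂μ₁
        = ∫ α, MvPolynomial.eval (fun i => α i) p ∂μ₂)
    {f P : EuclideanSpace ℝ (Fin d) → ℝ} {B : ℝ} (hf : Continuous f) (hP : IsPolyFun L P)
    (hB : ∀ α ∈ K, |f α - P α| ≤ B) :
    |(∫ α, f α ∂μ₁) - ∫ α, f α ∂μ₂| ≤ B * (μ₁.real Set.univ + μ₂.real Set.univ) := by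
  have hPc := hP.continuous
  have key : ∀ μ : Measure (EuclideanSpace ℝ (Fin d)), IsFiniteMeasure μ → μ Kᶜ = 0 →
      |(∫ α, f α ∂μ) - ∫ α, P α ∂μ| ≤ B * μ.real Set.univ := by
    intro μ _ hμ
    have hae : ∀ᵐ α ∂μ, α ∈ K := mem_ae_iff.mpr hμ
    have hint : ∀ h : EuclideanSpace ℝ (Fin d) → ℝ, Continuous h → Integrable h μ := by
      intro h hh
      rw [← Measure.restrict_eq_self_of_ae_mem hae]
      exact hh.continuousOn.integrableOn_compact hK
    rw [← integral_sub (hint f hf) (hint P hPc), ← Real.norm_eq_abs]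
    exact norm_integral_le_of_norm_le_const (hae.mono fun α hα => hB α hα)
  have heq : ∫ α, P α ∂μ₁ = ∫ α, P α ∂μ₂ := by
    obtain ⟨p, hp, hpP⟩ := hP
    simpa only [hpP] using hann p hp
  have h1 := key μ₁ inferInstance hμ₁
  have h2 := key μ₂ inferInstance hμ₂
  rw [heq] at h1
  rw [abs_sub_comm] at h2
  calc _ ≤ _ := abs_sub_le _ (∫ α, P α ∂μ₂) _
    _ ≤ _ := add_le_add h1 h2
    _ = _ := by ring

lemma surfSpline_of_add_eq {m d k : ℕ} (hk : d + k = 2 * m) (x : EuclideanSpace ℝ (Fin d)) :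
    surfSpline m d x = if Even d then ‖x‖ ^ k * Real.log ‖x‖ else ‖x‖ ^ k := by
  have h : 2 * (m : ℝ) - d = (k : ℝ) := by
    rw [sub_eq_iff_eq_add']
    exact_mod_cast hk.symm
  rw [surfSpline, h, Real.rpow_natCast]

lemma continuous_surfSpline {m d : ℕ} (hm : d < 2 * m) : Continuous (surfSpline m d) := by
  obtain ⟨k, hk⟩ := Nat.exists_eq_add_of_lt hm
  rw [funext (surfSpline_of_add_eq (k := k + 1) (by omega))]
  split_ifs
  · simp only [pow_succ, mul_assoc]
    exact (by fun_prop : Continuous fun x : EuclideanSpace ℝ (Fin d) => ‖x‖ ^ k).mul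
      (Real.continuous_mul_log.comp continuous_norm)
  · fun_prop

/-- Up to polynomials of degree at most `k = 2 * m - d` in `α`, the function `φ (x - α)` is
`‖x‖ ^ k` times an analytic function of `(‖x - α‖ / ‖x‖) ^ 2 - 1`. -/
lemma exists_analyticAt_surfSpline_sub {m d k : ℕ} (hk : d + k = 2 * m) :
    ∃ g : ℝ → ℝ, AnalyticAt ℝ g 0 ∧ ∀ x : EuclideanSpace ℝ (Fin d), x ≠ 0 →
      ∃ Q : EuclideanSpace ℝ (Fin d) → ℝ, IsPolyFun k Q ∧
        ∀ (α : EuclideanSpace ℝ (Fin d)) (s : ℝ), -1 < s → ‖x - α‖ ^ 2 = ‖x‖ ^ 2 * (1 + s) →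
          surfSpline m d (x - α) = ‖x‖ ^ k * g s + Q α := by
  have hnorm : ∀ (x α : EuclideanSpace ℝ (Fin d)) (s : ℝ),
      ‖x - α‖ ^ 2 = ‖x‖ ^ 2 * (1 + s) → ‖x - α‖ = ‖x‖ * Real.sqrt (1 + s) := by
    intro x α s h
    rw [← Real.sqrt_sq (norm_nonneg (x - α)), h, Real.sqrt_mul (by positivity),
      Real.sqrt_sq (norm_nonneg x)]
  by_cases hd : Even d
  · obtain ⟨e, he⟩ : Even k := by
      have : Even (d + k) := hk ▸ even_two_mul m
      exact (Nat.even_add.mp this).mp hd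
    refine ⟨fun s => (1 + s) ^ e * (Real.log (1 + s) / 2), ?_, fun x hx =>
      ⟨fun α => Real.log ‖x‖ * (‖x - α‖ ^ 2) ^ e, ?_, fun α s hs h => ?_⟩⟩
    · have : AnalyticAt ℝ (fun s : ℝ => Real.log (1 + s)) 0 :=
        AnalyticAt.log (by fun_prop) (by norm_num)
      fun_prop
    · exact (((IsPolyFun.normSq_sub x).pow e).const_mul _).mono (by omega)
    · have hx' : ‖x‖ ≠ 0 := norm_ne_zero_iff.mpr hx
      have hs' : 0 < 1 + s := by linarith
      have hk2 : k = 2 * e := by omega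
      rw [surfSpline_of_add_eq hk, if_pos hd]
      simp only
      rw [hk2, pow_mul, pow_mul, h, hnorm x α s h,
        Real.log_mul hx' (Real.sqrt_pos.mpr hs').ne', Real.log_sqrt hs'.le,
        mul_pow]
      ring
  · refine ⟨fun s => Real.sqrt (1 + s) ^ k, ?_, fun x hx =>
      ⟨fun _ => 0, IsPolyFun.const 0, fun α s hs h => ?_⟩⟩
    · have : AnalyticAt ℝ (fun s : ℝ => Real.sqrt (1 + s)) 0 :=
        ((Real.contDiffAt_sqrt (by norm_num)).analyticAt).comp (by fun_prop)
      fun_prop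
    · rw [surfSpline_of_add_eq hk, if_neg hd, hnorm x α s h, mul_pow, add_zero]

/-- Uniform polynomial approximation of the translates of `φ` far from the origin. -/
lemma exists_surfSpline_sub_approx {m d k L : ℕ} (hk : d + k = 2 * m) (hkL : k ≤ L) {ρ : ℝ}
    (hρ : 0 < ρ) :
    ∃ C R : ℝ, 0 ≤ C ∧ 1 ≤ R ∧ ∀ x : EuclideanSpace ℝ (Fin d), R ≤ ‖x‖ →
      ∃ P : EuclideanSpace ℝ (Fin d) → ℝ, IsPolyFun L P ∧
        ∀ α : EuclideanSpace ℝ (Fin d), ‖α‖ ≤ ρ →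
          |surfSpline m d (x - α) - P α| ≤ C / ‖x‖ ^ (L + 1 - k) := by
  obtain ⟨g, hg, hgQ⟩ := exists_analyticAt_surfSpline_sub (d := d) hk
  obtain ⟨c, C, δ, hC, hδ, hCb⟩ := hg.exists_abs_sub_weightedTaylor_le L
  refine ⟨C * ρ ^ (L + 1), max 1 (max (ρ / δ) (4 * ρ)), by positivity, le_max_left _ _,
    fun x hx => ?_⟩
  have hx1 : 1 ≤ ‖x‖ := (le_max_left _ _).trans hx
  have hx2 : ρ / δ ≤ ‖x‖ := ((le_max_left _ _).trans (le_max_right _ _)).trans hx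
  have hx3 : 4 * ρ ≤ ‖x‖ := ((le_max_right _ _).trans (le_max_right _ _)).trans hx
  have hx0 : 0 < ‖x‖ := by linarith
  obtain ⟨Q, hQ, hQe⟩ := hgQ x (norm_pos_iff.mp hx0)
  let a : EuclideanSpace ℝ (Fin d) → ℝ := fun α => (‖x‖ ^ 2)⁻¹ * ‖α‖ ^ 2
  let b : EuclideanSpace ℝ (Fin d) → ℝ := fun α => (-2 * (‖x‖ ^ 2)⁻¹) * inner ℝ x α
  refine ⟨fun α => ‖x‖ ^ k * weightedTaylor c L (a α) (b α) + Q α,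
    ((isPolyFun_weightedTaylor c L (IsPolyFun.normSq.const_mul _)
      ((IsPolyFun.inner_left x).const_mul _)).const_mul _).add (hQ.mono hkL), fun α hα => ?_⟩
  have ht0 : 0 ≤ ρ / ‖x‖ := by positivity
  have htδ : ρ / ‖x‖ ≤ δ := (div_le_comm₀ hδ hx0).mp hx2
  have ht4 : ρ / ‖x‖ ≤ 1 / 4 := by
    rw [div_le_iff₀ hx0]
    linarith
  have ha : |a α| ≤ (ρ / ‖x‖) ^ 2 := by
    rw [abs_of_nonneg (by positivity), div_pow, div_eq_inv_mul]
    exact mul_le_mul_of_nonneg_left (by gcongr) (by positivity)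
  have hb : |b α| ≤ 2 * (ρ / ‖x‖) := calc
    |b α| = 2 * (‖x‖ ^ 2)⁻¹ * |inner ℝ x α| := by
      rw [abs_mul, abs_mul, abs_of_nonneg (inv_nonneg.mpr (sq_nonneg ‖x‖))]
      norm_num
    _ ≤ 2 * (‖x‖ ^ 2)⁻¹ * (‖x‖ * ρ) := by
      gcongr
      exact (abs_real_inner_le_norm x α).trans (by gcongr)
    _ = 2 * (ρ / ‖x‖) := by field_simp
  have hs : -1 < a α + b α := by
    have := neg_abs_le (b α)
    have : 0 ≤ a α := by positivity
    linarith
  have hsq : ‖x - α‖ ^ 2 = ‖x‖ ^ 2 * (1 + (a α + b α)) := by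
    rw [norm_sub_sq_real]
    simp only [a, b]
    field_simp
    ring
  rw [hQe α _ hs hsq]
  calc |‖x‖ ^ k * g (a α + b α) + Q α - (‖x‖ ^ k * weightedTaylor c L (a α) (b α) + Q α)|
      = ‖x‖ ^ k * |g (a α + b α) - weightedTaylor c L (a α) (b α)| := by
        rw [add_sub_add_right_eq_sub, ← mul_sub, abs_mul, abs_of_nonneg (by positivity)]
    _ ≤ ‖x‖ ^ k * (C * (ρ / ‖x‖) ^ (L + 1)) := by
        gcongr
        exact hCb _ _ _ ht0 htδ ha hb
    _ = C * ρ ^ (L + 1) / ‖x‖ ^ (L + 1 - k) := by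
        have : ‖x‖ ^ (L + 1) = ‖x‖ ^ k * ‖x‖ ^ (L + 1 - k) := by
          rw [← pow_add]
          congr 1
          omega
        rw [div_pow, this]
        field_simp

/-- (Lemma 2.1) If `μ = μ₁ - μ₂` is a compactly supported finite signed measure on `ℝ^d`
(represented through its Jordan decomposition as a difference of two finite positive
measures) annihilating all polynomials of total degree at most `L`, with `L ≥ 2m - d`,
then `|∫ φ_{m,d}(x - α) dμ(α)| ≤ C (1 + ‖x‖)^{2m-d-L-1}` for all `x`. -/
theorem conv_surfSpline_decay (m d L : ℕ) (hd : 1 ≤ d) (hm : d < 2 * m)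
    (hL : 2 * (m : ℤ) - d ≤ L)
    (μ₁ μ₂ : Measure (EuclideanSpace ℝ (Fin d)))
    [IsFiniteMeasure μ₁] [IsFiniteMeasure μ₂]
    (K : Set (EuclideanSpace ℝ (Fin d))) (hK : IsCompact K)
    (hμ₁ : μ₁ Kᶜ = 0) (hμ₂ : μ₂ Kᶜ = 0)
    (hann : ∀ p : MvPolynomial (Fin d) ℝ, p.totalDegree ≤ L →
      ∫ α, MvPolynomial.eval (fun i => α i) p ∂μ₁
        = ∫ α, MvPolynomial.eval (fun i => α i) p ∂μ₂) :
    ∃ C : ℝ, ∀ x : EuclideanSpace ℝ (Fin d),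
      |(∫ α, surfSpline m d (x - α) ∂μ₁) - ∫ α, surfSpline m d (x - α) ∂μ₂|
        ≤ C * (1 + ‖x‖) ^ (2 * (m : ℝ) - d - L - 1) := by
  obtain ⟨k, hk⟩ : ∃ k, d + k = 2 * m := ⟨2 * m - d, by omega⟩
  have hkL : k ≤ L := by omega
  obtain ⟨ρ, hρ, hKρ⟩ := hK.isBounded.exists_pos_norm_le
  obtain ⟨C, R, hC, hR, happrox⟩ := exists_surfSpline_sub_approx (d := d) hk hkL hρ
  have hcont := continuous_surfSpline hm
  obtain ⟨M, hM⟩ := (isCompact_closedBall (0 : EuclideanSpace ℝ (Fin d))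
    (R + ρ)).exists_bound_of_continuousOn hcont.continuousOn
  set n := L + 1 - k with hn
  set W := μ₁.real Set.univ + μ₂.real Set.univ
  have hW : 0 ≤ W := by positivity
  have hexp : 2 * (m : ℝ) - d - L - 1 = -(n : ℝ) := by
    have h1 : (d : ℝ) + k = 2 * m := by exact_mod_cast hk
    have h2 : (n : ℝ) + k = L + 1 := by exact_mod_cast (by omega : n + k = L + 1)
    linarith
  have hM0 : 0 ≤ M := (norm_nonneg _).trans (hM 0 (by simp; linarith))
  refine ⟨M * W * (1 + R) ^ n + C * W * 2 ^ n, fun x => ?_⟩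
  rw [hexp, Real.rpow_neg (by positivity), Real.rpow_natCast, ← div_eq_mul_inv]
  have hfc : Continuous fun α => surfSpline m d (x - α) := hcont.comp (by fun_prop)
  rw [le_div_iff₀ (by positivity)]
  rcases le_total ‖x‖ R with hx | hx
  · have hB := abs_integral_sub_integral_le hK hμ₁ hμ₂ hann hfc (IsPolyFun.const 0) (B := M)
      fun α hα => by
        rw [sub_zero]
        refine hM _ ?_
        rw [mem_closedBall_zero_iff]
        exact (norm_sub_le x α).trans (add_le_add hx (hKρ α hα))
    calc _ ≤ M * W * (1 + R) ^ n := by gcongr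
      _ ≤ _ := le_add_of_nonneg_right (by positivity)
  · obtain ⟨P, hP, hPb⟩ := happrox x hx
    have hx0 : 0 < ‖x‖ := by linarith
    have hB := abs_integral_sub_integral_le hK hμ₁ hμ₂ hann hfc hP
      fun α hα => hPb α (hKρ α hα)
    calc _ ≤ C / ‖x‖ ^ n * W * (2 * ‖x‖) ^ n := by
          gcongr
          linarith
      _ = C * W * 2 ^ n := by
          rw [mul_pow]
          field_simp
      _ ≤ _ := le_add_of_nonneg_left (by positivity)
end

section
/- Let m, d be integers with m > d/2, let φ = φ_{m,d} be the surface spline fundamental solution, and let μ be a compactly supported finite signed measure on ℝ^d which annihilates all polynomials of total degree at most m − 1, i.e., ∫ p dμ = 0 for every polynomial p in d variables with total degree ≤ m − 1. Then there exists a constant C such that for all x ∈ ℝ^d, |∫ φ(x − α) dμ(α)| ≤ C · (1 + ‖x‖)^{m−d} · log(2 + ‖x‖). -/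
open MeasureTheory

/-- `F x`, restricted to the ball of radius `R`, is approximated by polynomials of degree at most
`n` with error `O(‖x‖^{-(n+1)})` as `x` tends to infinity. -/
def PolyApprox {d : ℕ} (n : ℕ) (R : ℝ)
    (F : EuclideanSpace ℝ (Fin d) → EuclideanSpace ℝ (Fin d) → ℝ) : Prop :=
  ∃ C T : ℝ, ∀ x : EuclideanSpace ℝ (Fin d), T ≤ ‖x‖ →
    ∃ p : MvPolynomial (Fin d) ℝ, p.totalDegree ≤ n ∧
      ∀ α : EuclideanSpace ℝ (Fin d), ‖α‖ ≤ R →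
        |F x α - MvPolynomial.eval (fun i => α i) p| ≤ C * ‖x‖⁻¹ ^ (n + 1)

namespace PolyApprox

variable {d n : ℕ} {R : ℝ}
  {F G : EuclideanSpace ℝ (Fin d) → EuclideanSpace ℝ (Fin d) → ℝ}

theorem of_bound (C T : ℝ)
    (h : ∀ x, T ≤ ‖x‖ → ∀ α, ‖α‖ ≤ R → |F x α| ≤ C * ‖x‖⁻¹ ^ (n + 1)) :
    PolyApprox n R F :=
  ⟨C, T, fun x hx => ⟨0, by simp, fun α hα => by simpa using h x hx α hα⟩⟩

theorem of_polynomial (p : EuclideanSpace ℝ (Fin d) → MvPolynomial (Fin d) ℝ)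
    (hp : ∀ x, (p x).totalDegree ≤ n)
    (h : ∀ x α, F x α = MvPolynomial.eval (fun i => α i) (p x)) : PolyApprox n R F :=
  ⟨0, 0, fun x _ => ⟨p x, hp x, fun α _ => by simp [h]⟩⟩

theorem add (hF : PolyApprox n R F) (hG : PolyApprox n R G) :
    PolyApprox n R (fun x α => F x α + G x α) := by
  obtain ⟨C, T, h⟩ := hF
  obtain ⟨C', T', h'⟩ := hG
  refine ⟨C + C', max T T', fun x hx => ?_⟩
  obtain ⟨p, hp, hb⟩ := h x ((le_max_left _ _).trans hx)
  obtain ⟨q, hq, hb'⟩ := h' x ((le_max_right _ _).trans hx)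
  refine ⟨p + q, (MvPolynomial.totalDegree_add _ _).trans (max_le hp hq), fun α hα => ?_⟩
  rw [map_add, add_mul, add_sub_add_comm]
  exact (abs_add_le _ _).trans (add_le_add (hb α hα) (hb' α hα))

theorem const_mul (c : ℝ) (hF : PolyApprox n R F) :
    PolyApprox n R (fun x α => c * F x α) := by
  obtain ⟨C, T, h⟩ := hF
  refine ⟨|c| * C, T, fun x hx => ?_⟩
  obtain ⟨p, hp, hb⟩ := h x hx
  refine ⟨MvPolynomial.C c * p, ?_, fun α hα => ?_⟩
  · refine (MvPolynomial.totalDegree_mul _ _).trans ?_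
    simpa using hp
  · rw [map_mul, MvPolynomial.eval_C, ← mul_sub, abs_mul, mul_assoc]
    exact mul_le_mul_of_nonneg_left (hb α hα) (abs_nonneg c)

theorem sum {ι : Type*} (s : Finset ι)
    {F : ι → EuclideanSpace ℝ (Fin d) → EuclideanSpace ℝ (Fin d) → ℝ}
    (h : ∀ i ∈ s, PolyApprox n R (F i)) :
    PolyApprox n R (fun x α => ∑ i ∈ s, F i x α) := by
  classical
  induction s using Finset.induction_on with
  | empty => exact of_bound 0 0 (by simp)
  | insert a s ha ih =>
    simp only [Finset.sum_insert ha]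
    exact (h a (Finset.mem_insert_self _ _)).add
      (ih fun i hi => h i (Finset.mem_insert_of_mem hi))

end PolyApprox

/-- The relative increment `(‖x - α‖² - ‖x‖²) / ‖x‖²` of the squared norm. -/
noncomputable def relIncr {d : ℕ} (x α : EuclideanSpace ℝ (Fin d)) : ℝ :=
  ‖α‖ ^ 2 / ‖x‖ ^ 2 + -2 * inner ℝ x α / ‖x‖ ^ 2

theorem one_add_relIncr {d : ℕ} {x : EuclideanSpace ℝ (Fin d)} (hx : x ≠ 0)
    (α : EuclideanSpace ℝ (Fin d)) : 1 + relIncr x α = (‖x - α‖ / ‖x‖) ^ 2 := by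
  have : ‖x‖ ≠ 0 := norm_ne_zero_iff.mpr hx
  rw [relIncr, div_pow, norm_sub_sq_real]
  field_simp
  ring

theorem abs_sq_div_le {d : ℕ} {R : ℝ} {x α : EuclideanSpace ℝ (Fin d)} (hα : ‖α‖ ≤ R) :
    |‖α‖ ^ 2 / ‖x‖ ^ 2| ≤ R ^ 2 * ‖x‖⁻¹ ^ 2 := by
  rw [abs_of_nonneg (by positivity), inv_pow, ← div_eq_mul_inv]
  gcongr

theorem abs_inner_div_le {d : ℕ} {R : ℝ} {x α : EuclideanSpace ℝ (Fin d)} (hα : ‖α‖ ≤ R) :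
    |-2 * inner ℝ x α / ‖x‖ ^ 2| ≤ 2 * R * ‖x‖⁻¹ := by
  rcases eq_or_ne x 0 with rfl | hx
  · simp
  have hx' : 0 < ‖x‖ := norm_pos_iff.mpr hx
  have h1 : |inner ℝ x α| ≤ ‖x‖ * R :=
    (abs_real_inner_le_norm x α).trans (mul_le_mul_of_nonneg_left hα hx'.le)
  rw [abs_div, abs_mul, abs_of_pos (by positivity : 0 < ‖x‖ ^ 2), div_le_iff₀ (by positivity)]
  have : 2 * R * ‖x‖⁻¹ * ‖x‖ ^ 2 = 2 * (‖x‖ * R) := by field_simp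
  rw [this]
  norm_num
  exact h1

theorem abs_relIncr_le {d : ℕ} {R : ℝ} {x α : EuclideanSpace ℝ (Fin d)} (hx : 1 ≤ ‖x‖)
    (hα : ‖α‖ ≤ R) : |relIncr x α| ≤ (R ^ 2 + 2 * R) * ‖x‖⁻¹ := by
  have hu : ‖x‖⁻¹ ≤ 1 := inv_le_one_of_one_le₀ hx
  have hu0 : 0 ≤ ‖x‖⁻¹ := by positivity
  have h1 := abs_sq_div_le (x := x) hα
  have h2 := abs_inner_div_le (x := x) hα
  have h3 : ‖x‖⁻¹ ^ 2 ≤ ‖x‖⁻¹ := by nlinarith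
  have h4 := mul_le_mul_of_nonneg_left h3 (sq_nonneg R)
  refine (abs_add_le _ _).trans ?_
  linarith

theorem polyApprox_monomial {d : ℕ} (n i a : ℕ) {R : ℝ} (hR : 0 ≤ R) :
    PolyApprox (d := d) n R
      (fun x α => (‖α‖ ^ 2 / ‖x‖ ^ 2) ^ i * (-2 * inner ℝ x α / ‖x‖ ^ 2) ^ a) := by
  rcases le_or_gt (2 * i + a) n with h | h
  · refine PolyApprox.of_polynomial
      (fun x => (∑ k, MvPolynomial.C (1 / ‖x‖ ^ 2) * MvPolynomial.X k ^ 2) ^ i *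
        (∑ k, MvPolynomial.C (-2 * x k / ‖x‖ ^ 2) * MvPolynomial.X k) ^ a) (fun x => ?_) ?_
    · have h1 : (∑ k : Fin d, MvPolynomial.C (1 / ‖x‖ ^ 2) * MvPolynomial.X k ^ 2 :
          MvPolynomial (Fin d) ℝ).totalDegree ≤ 2 := by
        refine MvPolynomial.totalDegree_finsetSum_le fun k _ => ?_
        refine (MvPolynomial.totalDegree_mul _ _).trans ?_
        simp
      have h2 : (∑ k : Fin d, MvPolynomial.C (-2 * x k / ‖x‖ ^ 2) * MvPolynomial.X k :
          MvPolynomial (Fin d) ℝ).totalDegree ≤ 1 := by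
        refine MvPolynomial.totalDegree_finsetSum_le fun k _ => ?_
        refine (MvPolynomial.totalDegree_mul _ _).trans ?_
        simp
      refine (MvPolynomial.totalDegree_mul _ _).trans ?_
      have h3 := (MvPolynomial.totalDegree_pow _ i).trans (Nat.mul_le_mul_left i h1)
      have h4 := (MvPolynomial.totalDegree_pow _ a).trans (Nat.mul_le_mul_left a h2)
      omega
    · intro x α
      simp only [map_mul, map_pow, map_sum, MvPolynomial.eval_C, MvPolynomial.eval_X]
      rw [EuclideanSpace.real_norm_sq_eq α, EuclideanSpace.inner_eq_star_dotProduct, dotProduct,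
        Finset.sum_div, Finset.mul_sum, Finset.sum_div]
      congr 3
      · funext k
        ring
      · funext k
        simp
        ring
  · refine PolyApprox.of_bound ((R ^ 2) ^ i * (2 * R) ^ a) 1 fun x hx α hα => ?_
    have hu : ‖x‖⁻¹ ≤ 1 := inv_le_one_of_one_le₀ hx
    have hu0 : 0 ≤ ‖x‖⁻¹ := by positivity
    rw [abs_mul, abs_pow, abs_pow]
    calc _ ≤ (R ^ 2 * ‖x‖⁻¹ ^ 2) ^ i * (2 * R * ‖x‖⁻¹) ^ a := by
          gcongr
          · exact abs_sq_div_le hα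
          · exact abs_inner_div_le hα
      _ = (R ^ 2) ^ i * (2 * R) ^ a * ‖x‖⁻¹ ^ (2 * i + a) := by ring
      _ ≤ _ := mul_le_mul_of_nonneg_left (pow_le_pow_of_le_one hu0 hu h) (by positivity)

theorem polyApprox_relIncr_pow {d : ℕ} (n j : ℕ) {R : ℝ} (hR : 0 ≤ R) :
    PolyApprox (d := d) n R (fun x α => relIncr x α ^ j) := by
  simp only [relIncr, add_pow, mul_comm _ (Nat.cast (Nat.choose _ _) : ℝ)]
  exact PolyApprox.sum _ fun i _ => (polyApprox_monomial n i (j - i) hR).const_mul _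

theorem AnalyticAt.exists_taylor_bound {f : ℝ → ℝ} (hf : AnalyticAt ℝ f 0) (n : ℕ) :
    ∃ (c : ℕ → ℝ) (C δ : ℝ), 0 ≤ C ∧ 0 < δ ∧ ∀ s, |s| ≤ δ →
      |f s - ∑ j ∈ Finset.range n, c j * s ^ j| ≤ C * |s| ^ n := by
  obtain ⟨p, hp⟩ := hf
  obtain ⟨C, hC, h⟩ := (hp.isBigO_sub_partialSum_pow n).exists_nonneg
  obtain ⟨ε, hε, hb⟩ := Metric.eventually_nhds_iff.mp h.bound
  refine ⟨p.coeff, C, ε / 2, hC, by positivity, fun s hs => ?_⟩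
  have := @hb s (by rw [Real.dist_eq, sub_zero]; linarith)
  simpa [FormalMultilinearSeries.partialSum, mul_comm] using this

theorem AnalyticAt.polyApprox_relIncr {d : ℕ} {f : ℝ → ℝ} (hf : AnalyticAt ℝ f 0) (n : ℕ)
    {R : ℝ} (hR : 0 ≤ R) : PolyApprox (d := d) n R (fun x α => f (relIncr x α)) := by
  obtain ⟨c, C, δ, hC, hδ, h⟩ := hf.exists_taylor_bound (n + 1)
  have h1 : PolyApprox (d := d) n R
      (fun x α => ∑ j ∈ Finset.range (n + 1), c j * relIncr x α ^ j) :=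
    PolyApprox.sum _ fun j _ => (polyApprox_relIncr_pow n j hR).const_mul _
  have h2 : PolyApprox (d := d) n R
      (fun x α => f (relIncr x α) - ∑ j ∈ Finset.range (n + 1), c j * relIncr x α ^ j) := by
    refine PolyApprox.of_bound (C * (R ^ 2 + 2 * R) ^ (n + 1)) (max 1 ((R ^ 2 + 2 * R) / δ))
      fun x hx α hα => ?_
    have hx1 : 1 ≤ ‖x‖ := (le_max_left _ _).trans hx
    have hx2 : (R ^ 2 + 2 * R) / δ ≤ ‖x‖ := (le_max_right _ _).trans hx
    have hs := abs_relIncr_le hx1 hα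
    have hsδ : |relIncr x α| ≤ δ := by
      refine hs.trans ?_
      rw [← div_eq_mul_inv, div_le_iff₀ (by positivity)]
      rwa [div_le_iff₀' hδ] at hx2
    refine (h _ hsδ).trans ?_
    rw [mul_assoc, ← mul_pow]
    gcongr
  simpa using h1.add h2

theorem measurable_relIncr {d : ℕ} (x : EuclideanSpace ℝ (Fin d)) : Measurable (relIncr x) := by
  unfold relIncr
  fun_prop

theorem continuous_eval_coord {d : ℕ} (p : MvPolynomial (Fin d) ℝ) :
    Continuous fun α : EuclideanSpace ℝ (Fin d) => MvPolynomial.eval (fun i => α i) p := by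
  have : Continuous fun α : EuclideanSpace ℝ (Fin d) => fun i => α i := by fun_prop
  exact (MvPolynomial.continuous_eval p).comp this

/-- If `F x` is approximated by polynomials, then so are its integrals, up to the total mass. -/
theorem PolyApprox.integral_bound {d n : ℕ} {R : ℝ}
    {F : EuclideanSpace ℝ (Fin d) → EuclideanSpace ℝ (Fin d) → ℝ} (hF : PolyApprox n R F)
    (hmeas : ∀ x, Measurable (F x))
    (μ₁ μ₂ : Measure (EuclideanSpace ℝ (Fin d))) [IsFiniteMeasure μ₁] [IsFiniteMeasure μ₂]
    (hμ₁ : ∀ᵐ α ∂μ₁, ‖α‖ ≤ R) (hμ₂ : ∀ᵐ α ∂μ₂, ‖α‖ ≤ R)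
    (hann : ∀ p : MvPolynomial (Fin d) ℝ, p.totalDegree ≤ n →
      ∫ α, MvPolynomial.eval (fun i => α i) p ∂μ₁
        = ∫ α, MvPolynomial.eval (fun i => α i) p ∂μ₂) :
    ∃ C T : ℝ, ∀ x, T ≤ ‖x‖ → Integrable (F x) μ₁ ∧ Integrable (F x) μ₂ ∧
      |(∫ α, F x α ∂μ₁) - ∫ α, F x α ∂μ₂| ≤ C * ‖x‖⁻¹ ^ (n + 1) := by
  obtain ⟨C, T, h⟩ := hF
  refine ⟨C * μ₁.real Set.univ + C * μ₂.real Set.univ, T, fun x hx => ?_⟩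
  obtain ⟨p, hp, hb⟩ := h x hx
  have key : ∀ μ : Measure (EuclideanSpace ℝ (Fin d)), IsFiniteMeasure μ →
      (∀ᵐ α ∂μ, ‖α‖ ≤ R) → Integrable (F x) μ ∧
      |(∫ α, F x α ∂μ) - ∫ α, MvPolynomial.eval (fun i => α i) p ∂μ|
        ≤ C * ‖x‖⁻¹ ^ (n + 1) * μ.real Set.univ := by
    intro μ _ hμ
    have hbd : ∀ᵐ α ∂μ, ‖F x α - MvPolynomial.eval (fun i => α i) p‖ ≤ C * ‖x‖⁻¹ ^ (n + 1) :=
      hμ.mono fun α hα => hb α hα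
    have hpi : Integrable
        (fun α : EuclideanSpace ℝ (Fin d) => MvPolynomial.eval (fun i => α i) p) μ := by
      rw [← Measure.restrict_eq_self_of_ae_mem (s := Metric.closedBall 0 R)
        (hμ.mono fun α hα => by simpa using hα)]
      exact (continuous_eval_coord p).continuousOn.integrableOn_compact
        (isCompact_closedBall 0 R)
    have hdi : Integrable (fun α => F x α - MvPolynomial.eval (fun i => α i) p) μ :=
      Integrable.of_bound
        ((hmeas x).sub (continuous_eval_coord p).measurable).aestronglyMeasurable _ hbd
    have hFi : Integrable (F x) μ :=
      (hdi.add hpi).congr (ae_of_all _ fun α => sub_add_cancel _ _)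
    refine ⟨hFi, ?_⟩
    rw [← integral_sub hFi hpi]
    exact norm_integral_le_of_norm_le_const hbd
  obtain ⟨i₁, b₁⟩ := key μ₁ inferInstance hμ₁
  obtain ⟨i₂, b₂⟩ := key μ₂ inferInstance hμ₂
  refine ⟨i₁, i₂, ?_⟩
  rw [hann p hp] at b₁
  rw [abs_le] at *
  constructor <;> linarith [b₁.1, b₁.2, b₂.1, b₂.2]

theorem analyticAt_one_add_rpow (k : ℝ) : AnalyticAt ℝ (fun s : ℝ => (1 + s) ^ k) 0 := by
  have h : AnalyticAt ℝ (fun s : ℝ => Real.exp (Real.log (1 + s) * k)) 0 := by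
    have h1 : AnalyticAt ℝ (fun s : ℝ => 1 + s) 0 := analyticAt_const.add analyticAt_id
    exact ((h1.log (by norm_num)).mul analyticAt_const).rexp
  refine h.congr ?_
  filter_upwards [Ioi_mem_nhds (show (-1 : ℝ) < 0 by norm_num)] with s hs
  rw [Real.rpow_def_of_pos (by linarith [Set.mem_Ioi.mp hs])]

theorem analyticAt_one_add_rpow_mul_log (k : ℝ) :
    AnalyticAt ℝ (fun s : ℝ => (1 + s) ^ k * Real.log (1 + s)) 0 := by
  have h1 : AnalyticAt ℝ (fun s : ℝ => 1 + s) 0 := analyticAt_const.add analyticAt_id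
  exact (analyticAt_one_add_rpow k).mul (h1.log (by norm_num))

theorem norm_rpow_eq_relIncr {d : ℕ} {x : EuclideanSpace ℝ (Fin d)} (hx : x ≠ 0)
    (α : EuclideanSpace ℝ (Fin d)) (a : ℝ) :
    ‖x - α‖ ^ a = ‖x‖ ^ a * (1 + relIncr x α) ^ (a / 2) := by
  have hx' : 0 < ‖x‖ := norm_pos_iff.mpr hx
  rw [one_add_relIncr hx, ← Real.rpow_natCast, ← Real.rpow_mul (by positivity), Nat.cast_ofNat,
    mul_div_cancel₀ a two_ne_zero, ← Real.mul_rpow (by positivity) (by positivity),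
    mul_div_cancel₀ _ hx'.ne']

theorem norm_rpow_mul_log_eq_relIncr {d : ℕ} {x : EuclideanSpace ℝ (Fin d)} (hx : x ≠ 0)
    (α : EuclideanSpace ℝ (Fin d)) {a : ℝ} (ha : 0 < a) :
    ‖x - α‖ ^ a * Real.log ‖x - α‖ =
      ‖x‖ ^ a * (Real.log ‖x‖ * (1 + relIncr x α) ^ (a / 2) +
        1 / 2 * ((1 + relIncr x α) ^ (a / 2) * Real.log (1 + relIncr x α))) := by
  have hx' : 0 < ‖x‖ := norm_pos_iff.mpr hx
  rw [norm_rpow_eq_relIncr hx]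
  rcases eq_or_ne (x - α) 0 with h | h
  · have h0 : 1 + relIncr x α = 0 := by rw [one_add_relIncr hx, h]; simp
    rw [h0, Real.zero_rpow (by positivity)]
    simp
  · have hy : 0 < ‖x - α‖ := norm_pos_iff.mpr h
    have hl : Real.log (1 + relIncr x α) = 2 * (Real.log ‖x - α‖ - Real.log ‖x‖) := by
      rw [one_add_relIncr hx, Real.log_pow, Real.log_div hy.ne' hx'.ne']
      norm_num
    rw [hl]
    ring

/-- `φ_{m,d}` is bounded on balls. -/
theorem exists_bound_surfSpline {m d : ℕ} (hm : d < 2 * m) {M : ℝ} (hM : 1 ≤ M) :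
    ∃ B, 0 ≤ B ∧ ∀ y : EuclideanSpace ℝ (Fin d), ‖y‖ ≤ M → |surfSpline m d y| ≤ B := by
  set a : ℝ := 2 * (m : ℝ) - d with ha
  have ha0 : 0 < a := by
    have : (d : ℝ) < 2 * m := by exact_mod_cast hm
    linarith
  have hpow : ∀ y : EuclideanSpace ℝ (Fin d), ‖y‖ ≤ M → ‖y‖ ^ a ≤ M ^ a :=
    fun y hy => Real.rpow_le_rpow (norm_nonneg _) hy ha0.le
  have hM0 : 0 ≤ M ^ a := by positivity
  have hL : 0 ≤ Real.log M := Real.log_nonneg hM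
  refine ⟨M ^ a + M ^ a * Real.log M + 1 / a, by positivity, fun y hy => ?_⟩
  have hy0 : 0 ≤ ‖y‖ ^ a := by positivity
  have hML : 0 ≤ M ^ a * Real.log M := by positivity
  have h1a : 0 < 1 / a := by positivity
  unfold surfSpline
  split_ifs with hd
  · rcases eq_or_ne y 0 with rfl | hne
    · simp only [norm_zero, Real.log_zero, mul_zero, abs_zero]
      positivity
    have hpos : 0 < ‖y‖ := norm_pos_iff.mpr hne
    rcases le_or_gt ‖y‖ 1 with h1 | h1
    · have := Real.abs_log_mul_self_rpow_lt ‖y‖ a hpos h1 ha0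
      rw [mul_comm] at this
      linarith
    · have hlog : 0 ≤ Real.log ‖y‖ := Real.log_nonneg h1.le
      rw [abs_of_nonneg (by positivity)]
      have := mul_le_mul (hpow y hy) (Real.log_le_log hpos hy) hlog hM0
      linarith
  · rw [abs_of_nonneg hy0]
    linarith [hpow y hy]

theorem surfSpline_far_bound {m d : ℕ} (hm : d < 2 * m) {R : ℝ} (hR : 0 ≤ R)
    (μ₁ μ₂ : Measure (EuclideanSpace ℝ (Fin d))) [IsFiniteMeasure μ₁] [IsFiniteMeasure μ₂]
    (hμ₁ : ∀ᵐ α ∂μ₁, ‖α‖ ≤ R) (hμ₂ : ∀ᵐ α ∂μ₂, ‖α‖ ≤ R)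
    (hann : ∀ p : MvPolynomial (Fin d) ℝ, p.totalDegree ≤ m - 1 →
      ∫ α, MvPolynomial.eval (fun i => α i) p ∂μ₁
        = ∫ α, MvPolynomial.eval (fun i => α i) p ∂μ₂) :
    ∃ C T : ℝ, 0 ≤ C ∧ 1 ≤ T ∧ ∀ x, T ≤ ‖x‖ →
      |(∫ α, surfSpline m d (x - α) ∂μ₁) - ∫ α, surfSpline m d (x - α) ∂μ₂|
        ≤ C * ‖x‖ ^ ((m : ℝ) - d) * (1 + Real.log ‖x‖) := by
  set a : ℝ := 2 * (m : ℝ) - d with ha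
  have ha0 : 0 < a := by
    have : (d : ℝ) < 2 * m := by exact_mod_cast hm
    linarith
  have hm1 : m - 1 + 1 = m := by omega
  obtain ⟨C₁, T₁, h₁⟩ := ((analyticAt_one_add_rpow (a / 2)).polyApprox_relIncr (d := d) (m - 1)
    hR).integral_bound
    (fun x => by have := measurable_relIncr x; fun_prop) μ₁ μ₂ hμ₁ hμ₂ hann
  obtain ⟨C₂, T₂, h₂⟩ := ((analyticAt_one_add_rpow_mul_log (a / 2)).polyApprox_relIncr (d := d)
    (m - 1) hR).integral_bound
    (fun x => by have := measurable_relIncr x; fun_prop) μ₁ μ₂ hμ₁ hμ₂ hann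
  rw [hm1] at h₁ h₂
  refine ⟨|C₁| + |C₂|, max 1 (max T₁ T₂), by positivity, le_max_left _ _, fun x hx => ?_⟩
  have hx1 : 1 ≤ ‖x‖ := (le_max_left _ _).trans hx
  have hx0 : 0 < ‖x‖ := by linarith
  have hxne : x ≠ 0 := norm_pos_iff.mp hx0
  obtain ⟨i₁, j₁, b₁⟩ := h₁ x (((le_max_left _ _).trans (le_max_right _ _)).trans hx)
  obtain ⟨i₂, j₂, b₂⟩ := h₂ x (((le_max_right _ _).trans (le_max_right _ _)).trans hx)
  have hlog : 0 ≤ Real.log ‖x‖ := Real.log_nonneg hx1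
  have hpow : ‖x‖ ^ ((m : ℝ) - d) = ‖x‖ ^ a * ‖x‖⁻¹ ^ m := by
    rw [inv_pow, ← Real.rpow_natCast, ← Real.rpow_neg hx0.le, ← Real.rpow_add hx0]
    congr 1
    rw [ha]; ring
  have hu : 0 ≤ ‖x‖⁻¹ ^ m := by positivity
  have hxa : 0 ≤ ‖x‖ ^ a := by positivity
  have c₁ := b₁.trans (mul_le_mul_of_nonneg_right (le_abs_self C₁) hu)
  have c₂ := b₂.trans (mul_le_mul_of_nonneg_right (le_abs_self C₂) hu)
  rw [hpow]
  unfold surfSpline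
  rw [← ha]
  split_ifs with hd
  · simp only [norm_rpow_mul_log_eq_relIncr hxne _ ha0, integral_const_mul]
    rw [integral_add (i₁.const_mul _) (i₂.const_mul _),
      integral_add (j₁.const_mul _) (j₂.const_mul _)]
    simp only [integral_const_mul]
    rw [← mul_sub, add_sub_add_comm, ← mul_sub, ← mul_sub, abs_mul, abs_of_nonneg hxa]
    have : (|C₁| + |C₂|) * (‖x‖ ^ a * ‖x‖⁻¹ ^ m) * (1 + Real.log ‖x‖) =
      ‖x‖ ^ a * ((|C₁| + |C₂|) * ‖x‖⁻¹ ^ m * (1 + Real.log ‖x‖)) := by ring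
    rw [this]
    refine mul_le_mul_of_nonneg_left ((abs_add_le _ _).trans ?_) hxa
    rw [abs_mul, abs_mul, abs_of_nonneg hlog, abs_of_pos (by norm_num : (0 : ℝ) < 1 / 2)]
    have e₁ := mul_le_mul_of_nonneg_left c₁ hlog
    have e₂ : 0 ≤ |C₁| * ‖x‖⁻¹ ^ m := by positivity
    have e₃ : 0 ≤ |C₂| * ‖x‖⁻¹ ^ m := by positivity
    have e₄ := mul_nonneg e₃ hlog
    nlinarith
  · simp only [norm_rpow_eq_relIncr hxne, integral_const_mul]
    rw [← mul_sub, abs_mul, abs_of_nonneg hxa]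
    have e₁ := mul_le_mul_of_nonneg_left c₁ hxa
    have e₂ : 0 ≤ ‖x‖ ^ a * (|C₂| * ‖x‖⁻¹ ^ m) := by positivity
    have e₃ : 0 ≤ (|C₁| + |C₂|) * (‖x‖ ^ a * ‖x‖⁻¹ ^ m) * Real.log ‖x‖ := by positivity
    linarith

theorem rpow_le_two_rpow_mul_one_add_rpow {r : ℝ} (hr : 1 ≤ r) (b : ℝ) :
    r ^ b ≤ 2 ^ |b| * (1 + r) ^ b := by
  rcases le_total 0 b with hb | hb
  · have h1 : r ^ b ≤ (1 + r) ^ b := Real.rpow_le_rpow (by linarith) (by linarith) hb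
    have h2 : (1 : ℝ) ≤ 2 ^ |b| := Real.one_le_rpow (by norm_num) (abs_nonneg b)
    have h3 : 0 ≤ (1 + r) ^ b := by positivity
    nlinarith
  · have h1 : (2 * r) ^ b ≤ (1 + r) ^ b :=
      Real.rpow_le_rpow_of_nonpos (by linarith) (by linarith) hb
    rw [Real.mul_rpow (by norm_num) (by linarith)] at h1
    have h2 : (0 : ℝ) < 2 ^ |b| := by positivity
    have h3 : (2 : ℝ) ^ |b| * 2 ^ b = 1 := by
      rw [← Real.rpow_add (by norm_num), abs_of_nonpos hb]; simp
    calc r ^ b = 2 ^ |b| * (2 ^ b * r ^ b) := by rw [← mul_assoc, h3, one_mul]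
      _ ≤ _ := mul_le_mul_of_nonneg_left h1 h2.le

theorem one_le_rpow_abs_mul_one_add_rpow {r T : ℝ} (hr : 0 ≤ r) (hrT : r ≤ T) (b : ℝ) :
    1 ≤ (1 + T) ^ |b| * (1 + r) ^ b := by
  have h1 : (1 + r) ^ |b| ≤ (1 + T) ^ |b| :=
    Real.rpow_le_rpow (by linarith) (by linarith) (abs_nonneg b)
  have h2 : 1 ≤ (1 + r) ^ |b| * (1 + r) ^ b := by
    rw [← Real.rpow_add (by linarith)]
    exact Real.one_le_rpow (by linarith) (by linarith [neg_abs_le b])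
  exact h2.trans (mul_le_mul_of_nonneg_right h1 (by positivity))

/-- If `μ = μ₁ - μ₂` is a compactly supported finite signed measure on `ℝ^d`
(represented through its Jordan decomposition as a difference of two finite positive
measures) annihilating all polynomials of total degree at most `m - 1`, then
`|∫ φ_{m,d}(x - α) dμ(α)| ≤ C (1 + ‖x‖)^{m-d} log(2 + ‖x‖)` for all `x`. -/
theorem conv_surfSpline_growth (m d : ℕ) (hd : 1 ≤ d) (hm : d < 2 * m)
    (μ₁ μ₂ : Measure (EuclideanSpace ℝ (Fin d)))
    [IsFiniteMeasure μ₁] [IsFiniteMeasure μ₂]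
    (K : Set (EuclideanSpace ℝ (Fin d))) (hK : IsCompact K)
    (hμ₁ : μ₁ Kᶜ = 0) (hμ₂ : μ₂ Kᶜ = 0)
    (hann : ∀ p : MvPolynomial (Fin d) ℝ, p.totalDegree ≤ m - 1 →
      ∫ α, MvPolynomial.eval (fun i => α i) p ∂μ₁
        = ∫ α, MvPolynomial.eval (fun i => α i) p ∂μ₂) :
    ∃ C : ℝ, ∀ x : EuclideanSpace ℝ (Fin d),
      |(∫ α, surfSpline m d (x - α) ∂μ₁) - ∫ α, surfSpline m d (x - α) ∂μ₂|
        ≤ C * (1 + ‖x‖) ^ ((m : ℝ) - d) * Real.log (2 + ‖x‖) := by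
  obtain ⟨R, hR, hKR⟩ := hK.isBounded.exists_pos_norm_le
  have hs : ∀ μ : Measure (EuclideanSpace ℝ (Fin d)), μ Kᶜ = 0 → ∀ᵐ α ∂μ, ‖α‖ ≤ R := by
    intro μ h
    filter_upwards [compl_mem_ae_iff.mpr h] with α hα
    exact hKR α (by simpa using hα)
  have hs₁ := hs μ₁ hμ₁
  have hs₂ := hs μ₂ hμ₂
  obtain ⟨C, T, hC, hT, hfar⟩ := surfSpline_far_bound hm hR.le μ₁ μ₂ hs₁ hs₂ hann
  obtain ⟨B, hB, hnear⟩ := exists_bound_surfSpline (m := m) (d := d) hm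
    (show (1 : ℝ) ≤ T + R by linarith)
  set b : ℝ := (m : ℝ) - d with hb
  set N : ℝ := B * μ₁.real Set.univ + B * μ₂.real Set.univ with hN
  have hN0 : 0 ≤ N := by positivity
  have hl2 : 0 < Real.log 2 := Real.log_pos (by norm_num)
  set C₁ : ℝ := N * (1 + T) ^ |b| / Real.log 2 with hC₁
  set C₂ : ℝ := C * 2 ^ |b| * (1 / Real.log 2 + 1) with hC₂
  have hC₁0 : 0 ≤ C₁ := by positivity
  have hC₂0 : 0 ≤ C₂ := by positivity
  refine ⟨C₁ + C₂, fun x => ?_⟩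
  have hx0 : 0 ≤ ‖x‖ := norm_nonneg x
  have hP : 0 ≤ (1 + ‖x‖) ^ b := by positivity
  have hL : Real.log 2 ≤ Real.log (2 + ‖x‖) := Real.log_le_log (by norm_num) (by linarith)
  have hL0 : 0 ≤ Real.log (2 + ‖x‖) := hl2.le.trans hL
  have hLdiv : 1 ≤ 1 / Real.log 2 * Real.log (2 + ‖x‖) := by
    rw [one_div, ← div_eq_inv_mul, one_le_div hl2]
    exact hL
  rw [add_mul, add_mul]
  have p₁ : 0 ≤ C₁ * (1 + ‖x‖) ^ b * Real.log (2 + ‖x‖) := by positivity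
  have p₂ : 0 ≤ C₂ * (1 + ‖x‖) ^ b * Real.log (2 + ‖x‖) := by positivity
  rcases le_total ‖x‖ T with hxT | hxT
  · have key : ∀ μ : Measure (EuclideanSpace ℝ (Fin d)), IsFiniteMeasure μ →
        (∀ᵐ α ∂μ, ‖α‖ ≤ R) → |∫ α, surfSpline m d (x - α) ∂μ| ≤ B * μ.real Set.univ :=
      fun μ _ hμ => norm_integral_le_of_norm_le_const
        (f := fun α => surfSpline m d (x - α)) (hμ.mono fun α hα =>
          hnear _ ((norm_sub_le _ _).trans (add_le_add hxT hα)))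
    have h1 : |(∫ α, surfSpline m d (x - α) ∂μ₁) - ∫ α, surfSpline m d (x - α) ∂μ₂| ≤ N :=
      (abs_sub _ _).trans (add_le_add (key μ₁ inferInstance hs₁) (key μ₂ inferInstance hs₂))
    have h2 := one_le_mul_of_one_le_of_one_le
      (one_le_rpow_abs_mul_one_add_rpow hx0 hxT b) hLdiv
    have h3 : C₁ * (1 + ‖x‖) ^ b * Real.log (2 + ‖x‖) =
        N * ((1 + T) ^ |b| * (1 + ‖x‖) ^ b * (1 / Real.log 2 * Real.log (2 + ‖x‖))) := by
      rw [hC₁]; ring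
    have h4 := mul_le_mul_of_nonneg_left h2 hN0
    linarith
  · have hx1 : 1 ≤ ‖x‖ := hT.trans hxT
    have h1 := hfar x hxT
    have h2 : Real.log ‖x‖ ≤ Real.log (2 + ‖x‖) :=
      Real.log_le_log (by linarith) (by linarith)
    have h3 : C * ‖x‖ ^ b * (1 + Real.log ‖x‖) ≤
        C * (2 ^ |b| * (1 + ‖x‖) ^ b) *
          (1 / Real.log 2 * Real.log (2 + ‖x‖) + Real.log (2 + ‖x‖)) := by
      have := Real.log_nonneg hx1
      gcongr
      exact rpow_le_two_rpow_mul_one_add_rpow hx1 b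
    have h4 : C * (2 ^ |b| * (1 + ‖x‖) ^ b) *
          (1 / Real.log 2 * Real.log (2 + ‖x‖) + Real.log (2 + ‖x‖)) =
        C₂ * (1 + ‖x‖) ^ b * Real.log (2 + ‖x‖) := by
      rw [hC₂]; ring
    linarith
end

section
/- Let m, d be integers with m > d/2, let φ = φ_{m,d} be the surface spline fundamental solution, and let μ be a finite signed measure on ℝ^d supported in the closed ball of radius R₀ > 0 centered at the origin, which annihilates all polynomials of total degree at most m − 1. Let u(x) = ∫ φ(x − α) dμ(α). Then for every natural number n with n + d > m, there exists a constant C such that for all x ∈ ℝ^d with ‖x‖ ≥ 2R₀, the n-th total derivative of u satisfies ‖D^n u(x)‖ ≤ C · ‖x‖^{m−d−n}. -/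
open MeasureTheory

open scoped ContDiff Topology

theorem sub_ne_zero_of_mem_closedBall {E : Type*} [SeminormedAddCommGroup E] {R : ℝ}
    {y α : E} (hy : R < ‖y‖) (hα : α ∈ Metric.closedBall 0 R) : y - α ≠ 0 := by
  rw [mem_closedBall_zero_iff] at hα
  intro h
  rw [sub_eq_zero.1 h] at hy
  exact absurd hα (not_le.2 hy)

theorem ContinuousAt.continuousOn_comp_const_sub {E F : Type*} [SeminormedAddCommGroup E]
    [TopologicalSpace F] {g : E → F} (hg : ∀ z ≠ 0, ContinuousAt g z)
    {R : ℝ} {y : E} (hy : R < ‖y‖) :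
    ContinuousOn (fun α ↦ g (y - α)) (Metric.closedBall 0 R) := fun α hα ↦
  ((hg _ (sub_ne_zero_of_mem_closedBall hy hα)).comp (f := fun α ↦ y - α)
    (by fun_prop)).continuousWithinAt

section Calculus

variable {E F : Type*} [NormedAddCommGroup E] [NormedSpace ℝ E]
  [NormedAddCommGroup F] [NormedSpace ℝ F]

theorem norm_iteratedFDeriv_iteratedFDeriv (f : E → F) (j n : ℕ) (z : E) :
    ‖iteratedFDeriv ℝ j (iteratedFDeriv ℝ n f) z‖ = ‖iteratedFDeriv ℝ (n + j) f z‖ := by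
  induction n generalizing j with
  | zero =>
    rw [iteratedFDeriv_zero_eq_comp, LinearIsometryEquiv.norm_iteratedFDeriv_comp_left, zero_add]
  | succ n ih =>
    let L : (E →L[ℝ] (E [×n]→L[ℝ] F)) ≃ₗᵢ[ℝ] (E [×(n + 1)]→L[ℝ] F) :=
      (continuousMultilinearCurryLeftEquiv ℝ (fun _ ↦ E) F).symm
    have hL : iteratedFDeriv ℝ (n + 1) f = L ∘ fderiv ℝ (iteratedFDeriv ℝ n f) :=
      iteratedFDeriv_succ_eq_comp_left
    rw [hL, LinearIsometryEquiv.norm_iteratedFDeriv_comp_left (𝕜 := ℝ)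
      (F := E →L[ℝ] (E [×n]→L[ℝ] F)) (G := E [×(n + 1)]→L[ℝ] F) L, norm_iteratedFDeriv_fderiv, ih,
      show n + (j + 1) = n + 1 + j by ring]

/-- The iterated derivative of a dilated function, without any smoothness assumption. -/
theorem iteratedFDeriv_comp_smul_of_ne_zero (f : E → F) {a : ℝ} (ha : a ≠ 0) (k : ℕ) (x : E) :
    iteratedFDeriv ℝ k (fun y ↦ f (a • y)) x = a ^ k • iteratedFDeriv ℝ k f (a • x) := by
  let g : E ≃L[ℝ] E := .equivOfInverse (a • .id ℝ E) (a⁻¹ • .id ℝ E)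
    (fun y ↦ by simp [smul_smul, ha]) (fun y ↦ by simp [smul_smul, ha])
  have h := g.iteratedFDerivWithin_comp_right
    f (s := Set.univ) uniqueDiffOn_univ (x := x) (Set.mem_univ _) k
  simp only [Set.preimage_univ, iteratedFDerivWithin_univ] at h
  refine Eq.trans h ?_
  ext v
  have hv := (iteratedFDeriv ℝ k f (a • x)).map_smul_univ (fun _ ↦ a) v
  rw [Finset.prod_const, Finset.card_univ, Fintype.card_fin] at hv
  exact hv

end Calculus

section Potential

variable {E F : Type*} [NormedAddCommGroup E] [NormedSpace ℝ E] [FiniteDimensional ℝ E]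
  [MeasurableSpace E] [BorelSpace E] [NormedAddCommGroup F]

theorem ContinuousOn.integrable_of_measure_compl_closedBall {g : E → F} {μ : Measure E}
    [IsFiniteMeasure μ] {R : ℝ} (hμ : μ (Metric.closedBall 0 R)ᶜ = 0)
    (hg : ContinuousOn g (Metric.closedBall 0 R)) : Integrable g μ := by
  have := FiniteDimensional.proper ℝ E
  have h := hg.integrableOn_compact (μ := μ) (isCompact_closedBall 0 R)
  have hae : ∀ᵐ x ∂μ, x ∈ Metric.closedBall (0 : E) R := mem_ae_iff.2 hμ
  rwa [IntegrableOn, Measure.restrict_eq_self_of_ae_mem hae] at h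

variable [NormedSpace ℝ F]

/-- Differentiation of a potential outside a ball carrying the measure. -/
theorem hasFDerivAt_integral_comp_sub {f : E → F} (hf : ∀ z ≠ 0, ContDiffAt ℝ 1 f z)
    {μ : Measure E} [IsFiniteMeasure μ] {R : ℝ} (hμ : μ (Metric.closedBall 0 R)ᶜ = 0)
    {y : E} (hy : R < ‖y‖) :
    HasFDerivAt (fun y ↦ ∫ α, f (y - α) ∂μ) (∫ α, fderiv ℝ f (y - α) ∂μ) y := by
  have := FiniteDimensional.proper ℝ E
  have hf' : ∀ z ≠ 0, ContinuousAt (fderiv ℝ f) z := fun z hz ↦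
    ((hf z hz).fderiv_right (m := 0) (by simp)).continuousAt
  obtain ⟨ε, hε, hεy⟩ : ∃ ε > 0, ∀ y' ∈ Metric.closedBall y ε, R < ‖y'‖ := by
    have : {y' : E | R < ‖y'‖} ∈ 𝓝 y := (isOpen_lt continuous_const continuous_norm).mem_nhds hy
    exact Metric.nhds_basis_closedBall.mem_iff.1 this
  obtain ⟨C, hC⟩ := ((isCompact_closedBall y ε).prod
    (isCompact_closedBall (0 : E) R)).exists_bound_of_continuousOn
    (f := fun p : E × E ↦ fderiv ℝ f (p.1 - p.2)) (fun p hp ↦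
      ((hf' _ (sub_ne_zero_of_mem_closedBall (hεy _ hp.1) hp.2)).comp
        (f := fun p : E × E ↦ p.1 - p.2) (by fun_prop)).continuousWithinAt)
  have hint : ∀ y' ∈ Metric.closedBall y ε, Integrable (fun α ↦ f (y' - α)) μ := fun y' hy' ↦
    (ContinuousAt.continuousOn_comp_const_sub (fun z hz ↦ (hf z hz).continuousAt)
      (hεy y' hy')).integrable_of_measure_compl_closedBall hμ
  refine hasFDerivAt_integral_of_dominated_of_fderiv_le (F := fun y α ↦ f (y - α))
    (F' := fun y α ↦ fderiv ℝ f (y - α)) (bound := fun _ ↦ C)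
    (Metric.closedBall_mem_nhds y hε) ?_ (hint y (Metric.mem_closedBall_self hε.le)) ?_ ?_
    (integrable_const C) ?_
  · filter_upwards [Metric.closedBall_mem_nhds y hε] with y' hy'
    exact (hint y' hy').aestronglyMeasurable
  · exact ((ContinuousAt.continuousOn_comp_const_sub hf'
      hy).integrable_of_measure_compl_closedBall hμ).aestronglyMeasurable
  · filter_upwards [mem_ae_iff.2 hμ] with α hα y' hy' using hC (y', α) ⟨hy', hα⟩
  · filter_upwards [mem_ae_iff.2 hμ] with α hα y' hy'
    have h := (hf _ (sub_ne_zero_of_mem_closedBall (hεy _ hy') hα)).differentiableAt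
      (by simp) |>.hasFDerivAt
    simpa [Function.comp_def] using h.comp y' ((hasFDerivAt_id y').sub_const α)

theorem iteratedFDeriv_integral_comp_sub {f : E → F} (hf : ∀ z ≠ 0, ContDiffAt ℝ ∞ f z)
    {μ₁ μ₂ : Measure E} [IsFiniteMeasure μ₁] [IsFiniteMeasure μ₂] {R : ℝ}
    (hμ₁ : μ₁ (Metric.closedBall 0 R)ᶜ = 0) (hμ₂ : μ₂ (Metric.closedBall 0 R)ᶜ = 0)
    (n : ℕ) {y : E} (hy : R < ‖y‖) :
    iteratedFDeriv ℝ n (fun y ↦ (∫ α, f (y - α) ∂μ₁) - ∫ α, f (y - α) ∂μ₂) y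
      = (∫ α, iteratedFDeriv ℝ n f (y - α) ∂μ₁) - ∫ α, iteratedFDeriv ℝ n f (y - α) ∂μ₂ := by
  induction n generalizing y with
  | zero =>
    let L := (continuousMultilinearCurryFin0 ℝ E F).symm
    have hL : ∀ g : E → F, iteratedFDeriv ℝ 0 g = fun z ↦ L.toContinuousLinearEquiv (g z) :=
      fun _ ↦ iteratedFDeriv_zero_eq_comp
    simp only [hL, ContinuousLinearEquiv.integral_comp_comm, map_sub]
  | succ n ih =>
    have hn : ∀ z ≠ 0, ContDiffAt ℝ 1 (iteratedFDeriv ℝ n f) z := fun z hz ↦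
      (hf z hz).iteratedFDeriv_right (by exact_mod_cast le_top)
    have hev : iteratedFDeriv ℝ n (fun y ↦ (∫ α, f (y - α) ∂μ₁) - ∫ α, f (y - α) ∂μ₂) =ᶠ[𝓝 y]
        fun y ↦ (∫ α, iteratedFDeriv ℝ n f (y - α) ∂μ₁)
          - ∫ α, iteratedFDeriv ℝ n f (y - α) ∂μ₂ := by
      filter_upwards [(isOpen_lt continuous_const continuous_norm).mem_nhds hy] with y' hy'
        using ih hy'
    let L : (E →L[ℝ] (E [×n]→L[ℝ] F)) ≃ₗᵢ[ℝ] (E [×(n + 1)]→L[ℝ] F) :=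
      (continuousMultilinearCurryLeftEquiv ℝ (fun _ ↦ E) F).symm
    have hL : ∀ g : E → F, iteratedFDeriv ℝ (n + 1) g =
        fun z ↦ L.toContinuousLinearEquiv (fderiv ℝ (iteratedFDeriv ℝ n g) z) :=
      fun _ ↦ iteratedFDeriv_succ_eq_comp_left
    simp only [hL]
    rw [hev.fderiv_eq, ((hasFDerivAt_integral_comp_sub hn hμ₁ hy).fun_sub
      (hasFDerivAt_integral_comp_sub hn hμ₂ hy)).fderiv, map_sub]
    have hLint : ∀ μ : Measure E,
        ∫ α, L.toContinuousLinearEquiv (fderiv ℝ (iteratedFDeriv ℝ n f) (y - α)) ∂μ =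
          L.toContinuousLinearEquiv (∫ α, fderiv ℝ (iteratedFDeriv ℝ n f) (y - α) ∂μ) := fun μ ↦
      ContinuousLinearEquiv.integral_comp_comm (𝕜 := ℝ)
        (E := E →L[ℝ] (E [×n]→L[ℝ] F)) (F := E [×(n + 1)]→L[ℝ] F) L.toContinuousLinearEquiv _
    rw [hLint, hLint]

end Potential

section Spline

theorem iteratedFDeriv_norm_pow_eq_zero {E : Type*} [NormedAddCommGroup E] [InnerProductSpace ℝ E]
    {N k : ℕ} (hN : Even N) (hk : N < k) (w : E) :
    iteratedFDeriv ℝ k (fun y : E ↦ ‖y‖ ^ N) w = 0 := by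
  have hsmooth : ContDiff ℝ k (fun y : E ↦ ‖y‖ ^ N) := by
    obtain ⟨j, rfl⟩ := hN
    simpa only [← two_mul, pow_mul] using (contDiff_norm_sq ℝ).pow j
  set D := iteratedFDeriv ℝ k (fun y : E ↦ ‖y‖ ^ N) with hD
  have hscale : ∀ a : ℝ, a ≠ 0 → D w = a ^ (k - N) • D (a • w) := by
    intro a ha
    have h := iteratedFDeriv_comp_smul_of_ne_zero (fun y : E ↦ ‖y‖ ^ N) ha k w
    have h' : (fun y : E ↦ ‖a • y‖ ^ N) = |a| ^ N • fun y : E ↦ ‖y‖ ^ N := by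
      ext y
      simp [norm_smul, mul_pow]
    rw [h', iteratedFDeriv_const_smul_apply hsmooth.contDiffAt, hN.pow_abs,
      show a ^ k = a ^ N * a ^ (k - N) by rw [← pow_add]; congr 1; omega, mul_smul] at h
    exact smul_right_injective _ (pow_ne_zero N ha) h
  have hcont : Continuous fun a : ℝ ↦ a ^ (k - N) • D (a • w) :=
    (continuous_pow _).smul ((hsmooth.continuous_iteratedFDeriv le_rfl).comp (by fun_prop))
  have h₀ := (hcont.tendsto 0).mono_left (nhdsWithin_le_nhds (s := {0}ᶜ))
  have h₁ : Filter.Tendsto (fun a : ℝ ↦ a ^ (k - N) • D (a • w)) (𝓝[≠] 0) (𝓝 (D w)) :=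
    tendsto_const_nhds.congr' (by
      filter_upwards [self_mem_nhdsWithin] with a ha using hscale a ha)
  simpa [zero_pow (Nat.sub_ne_zero_of_lt hk)] using tendsto_nhds_unique h₁ h₀

variable {m d : ℕ}

theorem surfSpline_eq_pow (hm : d < 2 * m) (x : EuclideanSpace ℝ (Fin d)) :
    surfSpline m d x =
      if Even d then ‖x‖ ^ (2 * m - d) * Real.log ‖x‖ else ‖x‖ ^ (2 * m - d) := by
  have h : (2 * (m : ℝ) - d) = ((2 * m - d : ℕ) : ℝ) := by
    rw [Nat.cast_sub hm.le]
    push_cast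
    rfl
  simp only [surfSpline, h, Real.rpow_natCast]

theorem contDiffAt_surfSpline (hm : d < 2 * m) {x : EuclideanSpace ℝ (Fin d)} (hx : x ≠ 0) :
    ContDiffAt ℝ ∞ (surfSpline m d) x := by
  rw [funext (surfSpline_eq_pow hm)]
  have h : ContDiffAt ℝ ∞ (fun y : EuclideanSpace ℝ (Fin d) ↦ ‖y‖) x := contDiffAt_norm ℝ hx
  split_ifs
  · exact (h.pow _).mul (h.log (norm_ne_zero_iff.2 hx))
  · exact h.pow _

theorem iteratedFDeriv_surfSpline_smul (hm : d < 2 * m) {k : ℕ} (hk : 2 * m - d < k) {a : ℝ}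
    (ha : 0 < a) {x : EuclideanSpace ℝ (Fin d)} (hx : x ≠ 0) :
    a ^ k • iteratedFDeriv ℝ k (surfSpline m d) (a • x)
      = a ^ (2 * m - d) • iteratedFDeriv ℝ k (surfSpline m d) x := by
  rw [← iteratedFDeriv_comp_smul_of_ne_zero _ ha.ne']
  have hφ : ContDiffAt ℝ k (surfSpline m d) x :=
    (contDiffAt_surfSpline hm hx).of_le (by exact_mod_cast le_top)
  by_cases hd : Even d
  · have hN : Even (2 * m - d) := (Nat.even_sub hm.le).2 (by simp [hd])
    have hsmooth : ContDiffAt ℝ k (fun y : EuclideanSpace ℝ (Fin d) ↦ ‖y‖ ^ (2 * m - d)) x :=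
      (contDiffAt_norm ℝ hx).pow _
    have h : (fun y ↦ surfSpline m d (a • y)) =ᶠ[𝓝 x] fun y ↦ a ^ (2 * m - d) • surfSpline m d y
        + (a ^ (2 * m - d) * Real.log a) • ‖y‖ ^ (2 * m - d) := by
      filter_upwards [isOpen_ne.mem_nhds hx] with y hy
      simp only [surfSpline_eq_pow hm, hd, if_true, norm_smul, Real.norm_of_nonneg ha.le,
        Real.log_mul ha.ne' (norm_ne_zero_iff.2 hy), smul_eq_mul]
      ring
    rw [(h.iteratedFDeriv ℝ k).eq_of_nhds,
      fun_iteratedFDeriv_add_apply (hφ.const_smul _) (hsmooth.const_smul _),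
      iteratedFDeriv_const_smul_apply' hφ, iteratedFDeriv_const_smul_apply' hsmooth,
      iteratedFDeriv_norm_pow_eq_zero hN hk, smul_zero, add_zero]
  · have h : (fun y ↦ surfSpline m d (a • y)) = a ^ (2 * m - d) • surfSpline m d := by
      ext y
      simp [surfSpline_eq_pow hm, hd, norm_smul, abs_of_pos ha, mul_pow]
    rw [h, iteratedFDeriv_const_smul_apply hφ]

theorem exists_norm_iteratedFDeriv_surfSpline_le (hm : d < 2 * m) {k : ℕ} (hk : 2 * m - d < k) :
    ∃ C, 0 ≤ C ∧ ∀ z : EuclideanSpace ℝ (Fin d), z ≠ 0 →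
      ‖iteratedFDeriv ℝ k (surfSpline m d) z‖ ≤ C * ‖z‖ ^ (2 * (m : ℝ) - d - k) := by
  obtain ⟨C, hC⟩ := (isCompact_sphere (0 : EuclideanSpace ℝ (Fin d)) 1).exists_bound_of_continuousOn
    (f := iteratedFDeriv ℝ k (surfSpline m d)) fun z hz ↦
      ((contDiffAt_surfSpline hm (by rintro rfl; simp at hz)).iteratedFDeriv_right (m := 0)
        (by exact_mod_cast le_top)).continuousAt.continuousWithinAt
  refine ⟨max C 0, le_max_right _ _, fun z hz ↦ ?_⟩
  have hz' : 0 < ‖z‖ := norm_pos_iff.2 hz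
  have h := congrArg norm (iteratedFDeriv_surfSpline_smul hm hk hz'
    (x := ‖z‖⁻¹ • z) (by simp [hz]))
  rw [smul_inv_smul₀ hz'.ne', norm_smul, norm_smul, norm_pow, norm_pow, norm_norm] at h
  have hC' := (hC (‖z‖⁻¹ • z) (by simp [norm_smul, hz'.ne'])).trans (le_max_left C 0)
  have hpow : ‖z‖ ^ (2 * (m : ℝ) - d - k) = ‖z‖ ^ (2 * m - d) / ‖z‖ ^ k := by
    rw [Real.rpow_sub hz', Real.rpow_natCast, ← Real.rpow_natCast _ (2 * m - d),
      Nat.cast_sub hm.le]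
    push_cast
    rfl
  rw [hpow, mul_div_assoc', le_div_iff₀ (pow_pos hz' k), mul_comm, h, mul_comm]
  gcongr

end Spline

section Moments

variable {d : ℕ} {F : Type*} [NormedAddCommGroup F] [NormedSpace ℝ F]

theorem ContinuousMultilinearMap.apply_neg_eq_sum_eval {k : ℕ}
    (M : ContinuousMultilinearMap ℝ (fun _ : Fin k ↦ EuclideanSpace ℝ (Fin d)) F)
    (α : EuclideanSpace ℝ (Fin d)) :
    M (fun _ ↦ -α) = ∑ σ : Fin k → Fin d,
      MvPolynomial.eval (fun i ↦ α i) (∏ j, -MvPolynomial.X (σ j)) •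
        M (fun j ↦ EuclideanSpace.basisFun (Fin d) ℝ (σ j)) := by
  conv_lhs =>
    rw [show (fun _ : Fin k ↦ -α) = fun _ : Fin k ↦
      ∑ i, (-α i) • EuclideanSpace.basisFun (Fin d) ℝ i by
        ext1
        simpa using ((EuclideanSpace.basisFun (Fin d) ℝ).sum_repr (-α)).symm]
  rw [M.map_sum]
  refine Finset.sum_congr rfl fun σ _ ↦ ?_
  rw [M.map_smul_univ (fun j ↦ -α (σ j))]
  simp

theorem integral_multilinear_neg_eq_of_annihilates [CompleteSpace F]
    {μ₁ μ₂ : Measure (EuclideanSpace ℝ (Fin d))}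
    [IsFiniteMeasure μ₁] [IsFiniteMeasure μ₂] {R : ℝ}
    (hμ₁ : μ₁ (Metric.closedBall 0 R)ᶜ = 0) (hμ₂ : μ₂ (Metric.closedBall 0 R)ᶜ = 0) {D : ℕ}
    (hann : ∀ p : MvPolynomial (Fin d) ℝ, p.totalDegree ≤ D →
      ∫ α, MvPolynomial.eval (fun i => α i) p ∂μ₁
        = ∫ α, MvPolynomial.eval (fun i => α i) p ∂μ₂)
    {k : ℕ} (hk : k ≤ D)
    (M : ContinuousMultilinearMap ℝ (fun _ : Fin k ↦ EuclideanSpace ℝ (Fin d)) F) :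
    ∫ α, M (fun _ ↦ -α) ∂μ₁ = ∫ α, M (fun _ ↦ -α) ∂μ₂ := by
  have hint : ∀ {μ : Measure (EuclideanSpace ℝ (Fin d))} [IsFiniteMeasure μ],
      μ (Metric.closedBall 0 R)ᶜ = 0 → ∀ (p : MvPolynomial (Fin d) ℝ) (v : F),
      Integrable (fun α : EuclideanSpace ℝ (Fin d) ↦
        MvPolynomial.eval (fun i ↦ α i) p • v) μ := by
    intro μ _ hμ p v
    refine ContinuousOn.integrable_of_measure_compl_closedBall hμ (Continuous.continuousOn ?_)
    exact ((MvPolynomial.continuous_eval p).comp (by fun_prop)).smul continuous_const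
  simp only [M.apply_neg_eq_sum_eval]
  rw [integral_finsetSum _ fun σ _ ↦ hint hμ₁ _ _, integral_finsetSum _ fun σ _ ↦ hint hμ₂ _ _]
  refine Finset.sum_congr rfl fun σ _ ↦ ?_
  rw [integral_smul_const, integral_smul_const, hann]
  refine (MvPolynomial.totalDegree_finsetProd _ _).trans (le_trans ?_ hk)
  simp

end Moments

section Taylor

open scoped Nat

variable {E F : Type*} [NormedAddCommGroup E] [NormedSpace ℝ E]
  [NormedAddCommGroup F] [NormedSpace ℝ F] [CompleteSpace F]

theorem norm_sub_taylor_sum_le {f : E → F} {x y : E} {n : ℕ} {C : ℝ}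
    (hf : ∀ t ∈ Set.Icc (0 : ℝ) 1, ContDiffAt ℝ (n + 1) f (x + t • y))
    (hC : ∀ t ∈ Set.Icc (0 : ℝ) 1, ‖iteratedFDeriv ℝ (n + 1) f (x + t • y)‖ ≤ C) :
    ‖f (x + y) - ∑ k ∈ Finset.range (n + 1), (k ! : ℝ)⁻¹ • iteratedFDeriv ℝ k f x (fun _ ↦ y)‖
      ≤ C * ‖y‖ ^ (n + 1) := by
  have hC₀ : 0 ≤ C := (norm_nonneg _).trans (hC 0 (by simp))
  rw [map_add_eq_sum_add_integral_iteratedFDeriv hf, add_sub_cancel_left, norm_smul]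
  have hint : ‖∫ t in (0 : ℝ)..1,
      (1 - t) ^ n • iteratedFDeriv ℝ (n + 1) f (x + t • y) (fun _ ↦ y)‖
      ≤ C * ‖y‖ ^ (n + 1) * |1 - 0| := by
    refine intervalIntegral.norm_integral_le_of_norm_le_const fun t ht ↦ ?_
    rw [Set.uIoc_of_le zero_le_one] at ht
    rw [norm_smul, norm_pow, Real.norm_of_nonneg (sub_nonneg.2 ht.2)]
    have h := (iteratedFDeriv ℝ (n + 1) f (x + t • y)).le_of_opNorm_le (hC t ⟨ht.1.le, ht.2⟩)
      (fun _ ↦ y)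
    simp only [Finset.prod_const, Finset.card_univ, Fintype.card_fin] at h
    exact (mul_le_of_le_one_left (norm_nonneg _)
      (pow_le_one₀ (sub_nonneg.2 ht.2) (by linarith [ht.1]))).trans h
  have hfac : ‖(n ! : ℝ)⁻¹‖ ≤ 1 := by
    rw [norm_inv, Real.norm_natCast]
    exact inv_le_one_of_one_le₀ (by exact_mod_cast n.factorial_pos)
  simpa using (mul_le_of_le_one_left (norm_nonneg _) hfac).trans hint

end Taylor

/-- If `μ = μ₁ - μ₂` is a finite signed measure supported in the closed ball of radius
`R₀ > 0` (represented through its Jordan decomposition as a difference of two finite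
positive measures) annihilating all polynomials of total degree at most `m - 1`, and
`u(x) = ∫ φ_{m,d}(x - α) dμ(α)`, then for `n + d > m` one has
`‖D^n u(x)‖ ≤ C ‖x‖^{m-d-n}` for all `‖x‖ ≥ 2R₀`. -/
theorem potential_iteratedFDeriv_decay (m d : ℕ) (hd : 1 ≤ d) (hm : d < 2 * m)
    (R₀ : ℝ) (hR₀ : 0 < R₀)
    (μ₁ μ₂ : Measure (EuclideanSpace ℝ (Fin d)))
    [IsFiniteMeasure μ₁] [IsFiniteMeasure μ₂]
    (hμ₁ : μ₁ (Metric.closedBall 0 R₀)ᶜ = 0) (hμ₂ : μ₂ (Metric.closedBall 0 R₀)ᶜ = 0)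
    (hann : ∀ p : MvPolynomial (Fin d) ℝ, p.totalDegree ≤ m - 1 →
      ∫ α, MvPolynomial.eval (fun i => α i) p ∂μ₁
        = ∫ α, MvPolynomial.eval (fun i => α i) p ∂μ₂)
    (n : ℕ) (hn : m < n + d) :
    ∃ C : ℝ, ∀ x : EuclideanSpace ℝ (Fin d), 2 * R₀ ≤ ‖x‖ →
      ‖iteratedFDeriv ℝ n
          (fun y => (∫ α, surfSpline m d (y - α) ∂μ₁) - ∫ α, surfSpline m d (y - α) ∂μ₂) x‖
        ≤ C * ‖x‖ ^ ((m : ℝ) - d - n) := by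
  obtain ⟨M, rfl⟩ : ∃ M, m = M + 1 := ⟨m - 1, by omega⟩
  obtain ⟨C, hC₀, hC⟩ := exists_norm_iteratedFDeriv_surfSpline_le hm
    (k := n + (M + 1)) (by omega)
  set Φ := iteratedFDeriv ℝ n (surfSpline (M + 1) d)
  set e : ℝ := ((M + 1 : ℕ) : ℝ) - d - n with he
  have he₀ : e ≤ 0 := by
    have : ((M + 1 : ℕ) : ℝ) < n + d := by exact_mod_cast hn
    linarith
  refine ⟨C * (2⁻¹ : ℝ) ^ e * R₀ ^ (M + 1) * (μ₁.real Set.univ + μ₂.real Set.univ),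
    fun x hx ↦ ?_⟩
  have hx₀ : 0 < ‖x‖ := by linarith
  have hxR : R₀ < ‖x‖ := by linarith
  rw [iteratedFDeriv_integral_comp_sub (fun z hz ↦ contDiffAt_surfSpline hm hz) hμ₁ hμ₂ n hxR]
  set P : EuclideanSpace ℝ (Fin d) → _ := fun α ↦
    ∑ k ∈ Finset.range (M + 1), (k.factorial : ℝ)⁻¹ • iteratedFDeriv ℝ k Φ x (fun _ ↦ -α)
  have hΦ : ∀ z ≠ 0, ContDiffAt ℝ ∞ Φ z := fun z hz ↦
    (contDiffAt_surfSpline hm hz).iteratedFDeriv_right (by exact_mod_cast le_top)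
  have hrem : ∀ α ∈ Metric.closedBall (0 : EuclideanSpace ℝ (Fin d)) R₀,
      ‖Φ (x - α) - P α‖ ≤ C * (2⁻¹ * ‖x‖) ^ e * R₀ ^ (M + 1) := by
    intro α hα
    rw [mem_closedBall_zero_iff] at hα
    have hfar : ∀ t ∈ Set.Icc (0 : ℝ) 1, 2⁻¹ * ‖x‖ ≤ ‖x + t • -α‖ := by
      intro t ht
      have h₁ : ‖t • -α‖ ≤ R₀ := by
        rw [norm_smul, norm_neg, Real.norm_of_nonneg ht.1]
        exact (mul_le_of_le_one_left (norm_nonneg _) ht.2).trans hα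
      have h₂ := norm_sub_le_norm_add x (t • -α)
      linarith
    have hne : ∀ t ∈ Set.Icc (0 : ℝ) 1, x + t • -α ≠ 0 := fun t ht ↦
      norm_pos_iff.1 (lt_of_lt_of_le (by positivity) (hfar t ht))
    have h := norm_sub_taylor_sum_le (f := Φ) (x := x) (y := -α) (n := M)
      (C := C * (2⁻¹ * ‖x‖) ^ e)
      (fun t ht ↦ (hΦ _ (hne t ht)).of_le (by exact_mod_cast le_top)) (fun t ht ↦ by
        rw [norm_iteratedFDeriv_iteratedFDeriv]
        refine (hC _ (hne t ht)).trans ?_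
        have : 2 * ((M + 1 : ℕ) : ℝ) - d - (n + (M + 1) : ℕ) = e := by
          rw [he]
          push_cast
          ring
        rw [this]
        exact mul_le_mul_of_nonneg_left
          (Real.rpow_le_rpow_of_nonpos (by positivity) (hfar t ht) he₀) hC₀)
    rw [← sub_eq_add_neg, norm_neg] at h
    exact h.trans (by gcongr)
  have hterm : ∀ k, Continuous fun α : EuclideanSpace ℝ (Fin d) ↦
      (k.factorial : ℝ)⁻¹ • iteratedFDeriv ℝ k Φ x (fun _ ↦ -α) := fun k ↦
    Continuous.fun_const_smul
      ((iteratedFDeriv ℝ k Φ x).cont.comp (continuous_pi fun _ ↦ continuous_neg)) _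
  have hPcont : Continuous P := continuous_finsetSum _ fun k _ ↦ hterm k
  have hP : ∫ α, P α ∂μ₁ = ∫ α, P α ∂μ₂ := by
    simp only [P]
    rw [integral_finsetSum _ fun k _ ↦
        (hterm k).continuousOn.integrable_of_measure_compl_closedBall hμ₁,
      integral_finsetSum _ fun k _ ↦
        (hterm k).continuousOn.integrable_of_measure_compl_closedBall hμ₂]
    refine Finset.sum_congr rfl fun k hk ↦ ?_
    rw [integral_smul, integral_smul, integral_multilinear_neg_eq_of_annihilates hμ₁ hμ₂ hann
      (by have := Finset.mem_range.1 hk; omega)]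
  have hbound : ∀ {μ : Measure (EuclideanSpace ℝ (Fin d))} [IsFiniteMeasure μ],
      μ (Metric.closedBall 0 R₀)ᶜ = 0 → ‖(∫ α, Φ (x - α) ∂μ) - ∫ α, P α ∂μ‖
        ≤ C * (2⁻¹ * ‖x‖) ^ e * R₀ ^ (M + 1) * μ.real Set.univ := by
    intro μ _ hμ
    rw [← integral_sub
      ((ContinuousAt.continuousOn_comp_const_sub (fun z hz ↦ (hΦ z hz).continuousAt)
        hxR).integrable_of_measure_compl_closedBall hμ)
      (hPcont.continuousOn.integrable_of_measure_compl_closedBall hμ)]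
    exact norm_integral_le_of_norm_le_const (by
      filter_upwards [mem_ae_iff.2 hμ] with α hα using hrem α hα)
  calc ‖(∫ α, Φ (x - α) ∂μ₁) - ∫ α, Φ (x - α) ∂μ₂‖
      = ‖((∫ α, Φ (x - α) ∂μ₁) - ∫ α, P α ∂μ₁) - ((∫ α, Φ (x - α) ∂μ₂) - ∫ α, P α ∂μ₂)‖ := by
        rw [hP, sub_sub_sub_cancel_right]
    _ ≤ _ := (norm_sub_le _ _).trans (add_le_add (hbound hμ₁) (hbound hμ₂))
    _ = _ := by
        rw [Real.mul_rpow (by norm_num) hx₀.le]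
        ring
end
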